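/- arXiv:2102.10328 — 5 statements merged into one kernel-verified Lean document; each statement's English description precedes it below -/
import Mathlib

section
/- For every integer k ≥ 1 there exists a k-critical permutation of length at least (k/6)^{2.46}. In particular, for every k there exists a permutation that is not k-coverable although every pattern of it of length at most (k/6)^{2.46} is k-coverable. -/
/-- The subsequence of `π` indexed by `S` is increasing. -/
def IsIncOn {n : ℕ} (π : Equiv.Perm (Fin n)) (S : Set (Fin n)) : Prop :=
  ∀ i ∈ S, ∀ j ∈ S, i < j → π i < π j

/-- The subsequence of `π` indexed by `S` is decreasing. -/
def IsDecOn {n : ℕ} (π : Equiv.Perm (Fin n)) (S : Set (Fin n)) : Prop :=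
  ∀ i ∈ S, ∀ j ∈ S, i < j → π j < π i

/-- `π` is `(r,s)`-coverable: its index set can be partitioned into `r` sets
indexing increasing subsequences and `s` sets indexing decreasing subsequences. -/
def Coverable {n : ℕ} (π : Equiv.Perm (Fin n)) (r s : ℕ) : Prop :=
  ∃ c : Fin n → Fin r ⊕ Fin s,
    (∀ a : Fin r, IsIncOn π {i | c i = Sum.inl a}) ∧
    (∀ b : Fin s, IsDecOn π {i | c i = Sum.inr b})

/-- `π` is `k`-coverable: `(r,s)`-coverable for some `r + s = k`. -/
def KCoverable {n : ℕ} (π : Equiv.Perm (Fin n)) (k : ℕ) : Prop :=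
  ∃ r s, r + s = k ∧ Coverable π r s

/-- `τ` is a pattern of `π`. -/
def Pattern {m n : ℕ} (τ : Equiv.Perm (Fin m)) (π : Equiv.Perm (Fin n)) : Prop :=
  ∃ f : Fin m → Fin n, StrictMono f ∧ ∀ i j, τ i < τ j ↔ π (f i) < π (f j)

/-- `τ` is a proper pattern of `π`. -/
def ProperPattern {m n : ℕ} (τ : Equiv.Perm (Fin m)) (π : Equiv.Perm (Fin n)) : Prop :=
  m < n ∧ Pattern τ π

/-- `π` is `(r,s)`-critical. -/
def RSCritical {n : ℕ} (π : Equiv.Perm (Fin n)) (r s : ℕ) : Prop :=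
  ¬ Coverable π r s ∧
    ∀ (m : ℕ) (τ : Equiv.Perm (Fin m)), ProperPattern τ π → Coverable τ r s

/-- `π` is `k`-critical. -/
def KCritical {n : ℕ} (π : Equiv.Perm (Fin n)) (k : ℕ) : Prop :=
  ¬ KCoverable π k ∧
    ∀ (m : ℕ) (τ : Equiv.Perm (Fin m)), ProperPattern τ π → KCoverable τ k

/-- `π` is `(r,s)`-sharp: `(r,s)`-critical and `(0,s+1)`-coverable. -/
def RSSharp {n : ℕ} (π : Equiv.Perm (Fin n)) (r s : ℕ) : Prop :=
  RSCritical π r s ∧ Coverable π 0 (s + 1)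

/-- `D(π)`: the set of pairs `(r,s)` such that `π` is not `(r,s)`-coverable. -/
def DSet {n : ℕ} (π : Equiv.Perm (Fin n)) : Set (ℕ × ℕ) :=
  {p | ¬ Coverable π p.1 p.2}

/-- A downset: a finite, downward-closed subset of `ℕ²`. -/
def IsDownset (A : Set (ℕ × ℕ)) : Prop :=
  A.Finite ∧ ∀ p ∈ A, ∀ q : ℕ × ℕ, q.1 ≤ p.1 → q.2 ≤ p.2 → q ∈ A

/-- `A ⊕ B` for subsets of `ℕ²`. -/
def setOplus (A B : Set (ℕ × ℕ)) : Set (ℕ × ℕ) :=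
  {p | ∀ s₁ s₂ : ℕ, s₁ + s₂ = p.2 → (p.1, s₁) ∈ A ∨ (p.1, s₂) ∈ B}

/-- `A ⊖ B` for subsets of `ℕ²`. -/
def setOminus (A B : Set (ℕ × ℕ)) : Set (ℕ × ℕ) :=
  {p | ∀ r₁ r₂ : ℕ, r₁ + r₂ = p.1 → (r₁, p.2) ∈ A ∨ (r₂, p.2) ∈ B}

/-- `π` is `A`-coverable. -/
def ACoverable {n : ℕ} (π : Equiv.Perm (Fin n)) (A : Set (ℕ × ℕ)) : Prop :=
  ∃ p ∈ A, Coverable π p.1 p.2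

/-- `π` is `A`-critical. -/
def ACritical {n : ℕ} (π : Equiv.Perm (Fin n)) (A : Set (ℕ × ℕ)) : Prop :=
  ¬ ACoverable π A ∧
    ∀ (m : ℕ) (τ : Equiv.Perm (Fin m)), ProperPattern τ π → ACoverable τ A

/-- `π` is `A`-minimal: `A`-critical with `D(π) = A`. -/
def AMinimal {n : ℕ} (π : Equiv.Perm (Fin n)) (A : Set (ℕ × ℕ)) : Prop :=
  ACritical π A ∧ DSet π = A

/-- The triangle `T(k) = {(r,s) : r + s ≤ k}`. -/
def T (k : ℕ) : Set (ℕ × ℕ) := {p | p.1 + p.2 ≤ k}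

/-- Direct sum of permutations: `π` followed by `σ` shifted up by `n`. -/
def directSum {n m : ℕ} (π : Equiv.Perm (Fin n)) (σ : Equiv.Perm (Fin m)) :
    Equiv.Perm (Fin (n + m)) :=
  finSumFinEquiv.symm.trans ((Equiv.sumCongr π σ).trans finSumFinEquiv)

/-- Skew sum of permutations: `π` shifted up by `m`, followed by `σ`. -/
def skewSum {n m : ℕ} (π : Equiv.Perm (Fin n)) (σ : Equiv.Perm (Fin m)) :
    Equiv.Perm (Fin (n + m)) :=
  finSumFinEquiv.symm.trans (((Equiv.sumCongr π σ).trans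
    (Equiv.sumComm (Fin n) (Fin m))).trans
    (finSumFinEquiv.trans (finCongr (Nat.add_comm m n))))

/-- Tensor product of permutations: `n` copies of `σ`, ordered like `π`. -/
def tensorProd {n m : ℕ} (π : Equiv.Perm (Fin n)) (σ : Equiv.Perm (Fin m)) :
    Equiv.Perm (Fin (n * m)) :=
  finProdFinEquiv.symm.trans ((Equiv.prodCongr π σ).trans finProdFinEquiv)

/-! ### Covers of graphs by cliques and independent sets -/

/-- The vertices of `G` can be coloured so that the classes of colours in `ρ` are cliques and the
classes of colours in `κ` are independent. -/
def SplitColorable {α : Type*} (G : SimpleGraph α) (ρ κ : Type*) : Prop :=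
  ∃ c : α → ρ ⊕ κ, ∀ x y, x ≠ y → c x = c y → (G.Adj x y ↔ (c x).isLeft = true)

namespace SplitColorable

variable {α β ρ κ ρ' κ' : Type*} {G : SimpleGraph α} {H : SimpleGraph β}

theorem of_embedding (h : SplitColorable G ρ κ) (φ : H ↪g G) : SplitColorable H ρ κ := by
  obtain ⟨c, hc⟩ := h
  refine ⟨c ∘ φ, fun x y hxy hcxy => ?_⟩
  rw [← φ.map_adj_iff]
  exact hc _ _ (φ.injective.ne hxy) hcxy

theorem map (h : SplitColorable G ρ κ) (f : ρ ↪ ρ') (g : κ ↪ κ') : SplitColorable G ρ' κ' := by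
  obtain ⟨c, hc⟩ := h
  refine ⟨fun x => Sum.map f g (c x), fun x y hxy hcxy => ?_⟩
  rw [hc x y hxy (Sum.map_injective.2 ⟨f.injective, g.injective⟩ hcxy)]
  dsimp only
  cases c x <;> simp

theorem of_card_le [Fintype ρ] [Fintype κ] [Fintype ρ'] [Fintype κ']
    (h : SplitColorable G ρ κ) (hρ : Fintype.card ρ ≤ Fintype.card ρ')
    (hκ : Fintype.card κ ≤ Fintype.card κ') : SplitColorable G ρ' κ' := by
  obtain ⟨f⟩ := Function.Embedding.nonempty_of_card_le hρ
  obtain ⟨g⟩ := Function.Embedding.nonempty_of_card_le hκ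
  exact h.map f g

theorem mono {r s r' s' : ℕ} (h : SplitColorable G (Fin r) (Fin s)) (hr : r ≤ r') (hs : s ≤ s') :
    SplitColorable G (Fin r') (Fin s') :=
  h.of_card_le (by simpa using hr) (by simpa using hs)

theorem compl (h : SplitColorable G ρ κ) : SplitColorable Gᶜ κ ρ := by
  obtain ⟨c, hc⟩ := h
  refine ⟨fun x => (c x).swap, fun x y hxy hcxy => ?_⟩
  rw [SimpleGraph.compl_adj, hc x y hxy (Sum.swap_leftInverse.injective hcxy)]
  dsimp only
  cases c x <;> simp [hxy]

/-- Colour classes may be restricted to the sets of colours that occur. -/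
theorem of_finsets {c : α → ρ ⊕ κ}
    (hc : ∀ x y, x ≠ y → c x = c y → (G.Adj x y ↔ (c x).isLeft = true))
    (A : Finset ρ) (B : Finset κ) (hA : ∀ x a, c x = Sum.inl a → a ∈ A)
    (hB : ∀ x b, c x = Sum.inr b → b ∈ B) : SplitColorable G A B := by
  have key : ∀ x, ∃ d : A ⊕ B, Sum.map Subtype.val Subtype.val d = c x := by
    intro x
    rcases h : c x with a | b
    · exact ⟨Sum.inl ⟨a, hA x a h⟩, rfl⟩
    · exact ⟨Sum.inr ⟨b, hB x b h⟩, rfl⟩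
  choose d hd using key
  refine ⟨d, fun x y hxy hcxy => ?_⟩
  rw [hc x y hxy (by rw [← hd x, ← hd y, hcxy]), ← hd x]
  cases d x <;> simp

/-- One more clique suffices to cover a vertex that was deleted. -/
theorem of_induce_compl_singleton {x : α} (h : SplitColorable (G.induce {x}ᶜ) ρ κ) :
    SplitColorable G (Option ρ) κ := by
  classical
  obtain ⟨c, hc⟩ := h
  refine ⟨fun y => if hy : y = x then Sum.inl none else Sum.map some id (c ⟨y, hy⟩),
    fun y z hyz hcyz => ?_⟩
  by_cases hy : y = x
  · have hz : z ≠ x := fun hz => hyz (hy.trans hz.symm)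
    simp only [hy, hz, dite_true, dite_false] at hcyz
    rcases h : c ⟨z, hz⟩ with a | b <;> simp [h] at hcyz
  · by_cases hz : z = x
    · simp only [hy, hz, dite_true, dite_false] at hcyz
      rcases h : c ⟨y, hy⟩ with a | b <;> simp [h] at hcyz
    · simp only [hy, hz, dite_false] at hcyz ⊢
      have := hc ⟨y, hy⟩ ⟨z, hz⟩ (fun h => hyz (congrArg Subtype.val h))
        (Sum.map_injective.2 ⟨Option.some_injective _, Function.injective_id⟩ hcyz)
      rw [SimpleGraph.induce_adj] at this
      rw [this]
      cases c ⟨y, hy⟩ <;> simp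

end SplitColorable

/-! ### Graphs realized by points in the plane -/

/-- `G` is the graph of increasing pairs of a set of points in general position. -/
def Realizable {α : Type*} (G : SimpleGraph α) : Prop :=
  ∃ x y : α → ℕ, Function.Injective x ∧ Function.Injective y ∧
    ∀ a b, a ≠ b → (G.Adj a b ↔ (x a < x b ↔ y a < y b))

/-- The join of `G` with an edgeless graph on `β`. -/
def joinEmpty {α : Type*} (G : SimpleGraph α) (β : Type*) : SimpleGraph (α ⊕ β) where
  Adj
    | Sum.inl a, Sum.inl b => G.Adj a b
    | Sum.inr _, Sum.inr _ => False
    | _, _ => True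
  symm := ⟨by
    rintro (a | a) (b | b) h
    · exact G.adj_symm h
    · trivial
    · trivial
    · exact h⟩
  loopless := ⟨by
    rintro (a | a) h
    · exact G.irrefl h
    · exact h⟩

/-- The lexicographic product: every vertex of `G` is replaced by a copy of `H`. -/
def lexProduct {α β : Type*} (G : SimpleGraph α) (H : SimpleGraph β) : SimpleGraph (α × β) where
  Adj p q := G.Adj p.1 q.1 ∨ p.1 = q.1 ∧ H.Adj p.2 q.2
  symm := ⟨by
    rintro p q (h | ⟨h, h'⟩)
    · exact Or.inl h.symm
    · exact Or.inr ⟨h.symm, h'.symm⟩⟩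
  loopless := ⟨by
    rintro p (h | ⟨-, h⟩)
    · exact G.irrefl h
    · exact H.irrefl h⟩

theorem lexProduct_adj_of_ne {α β : Type*} {G : SimpleGraph α} {H : SimpleGraph β} {i j : α}
    (h : i ≠ j) (x y : β) : (lexProduct G H).Adj (i, x) (j, y) ↔ G.Adj i j := by
  simp [lexProduct, h]

theorem lexProduct_adj_same {α β : Type*} {G : SimpleGraph α} {H : SimpleGraph β} (i : α)
    (x y : β) : (lexProduct G H).Adj (i, x) (i, y) ↔ H.Adj x y := by
  simp [lexProduct]

theorem exists_forall_lt_of_finite {α : Type*} [Finite α] (x : α → ℕ) : ∃ M, ∀ a, x a < M := by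
  obtain ⟨M, hM⟩ := (Set.finite_range x).bddAbove
  exact ⟨M + 1, fun a => Nat.lt_succ_of_le (hM ⟨a, rfl⟩)⟩

namespace Realizable

variable {α β : Type*} {G : SimpleGraph α} {H : SimpleGraph β}

theorem compl [Finite α] (h : Realizable G) : Realizable Gᶜ := by
  obtain ⟨x, y, hx, hy, hG⟩ := h
  obtain ⟨M, hM⟩ := exists_forall_lt_of_finite y
  refine ⟨x, fun a => M - y a, hx, fun a b hab => hy ?_, fun a b hab => ?_⟩
  · have := hM a
    have := hM b
    dsimp only at hab
    omega
  · have := hM a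
    have := hM b
    have := hy.ne hab
    rw [SimpleGraph.compl_adj, hG a b hab]
    dsimp only
    have : M - y a < M - y b ↔ ¬ y a < y b := by omega
    rw [this]
    tauto

theorem joinEmpty [Finite α] (h : Realizable G) (ℓ : ℕ) : Realizable (joinEmpty G (Fin ℓ)) := by
  obtain ⟨x, y, hx, hy, hG⟩ := h
  obtain ⟨M, hM⟩ := exists_forall_lt_of_finite x
  obtain ⟨N, hN⟩ := exists_forall_lt_of_finite y
  refine ⟨Sum.elim x fun i => M + i, Sum.elim y fun i => N + (ℓ - i), ?_, ?_, ?_⟩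
  · rintro (a | i) (b | j) hab <;> simp only [Sum.elim_inl, Sum.elim_inr] at hab
    · rw [hx hab]
    · have := hM a
      omega
    · have := hM b
      omega
    · rw [Fin.ext (by omega : (i : ℕ) = j)]
  · rintro (a | i) (b | j) hab <;> simp only [Sum.elim_inl, Sum.elim_inr] at hab
    · rw [hy hab]
    · have := hN a
      omega
    · have := hN b
      omega
    · rw [Fin.ext (by omega : (i : ℕ) = j)]
  · rintro (a | i) (b | j) hab <;> simp only [Sum.elim_inl, Sum.elim_inr, _root_.joinEmpty]
    · exact hG a b fun h => hab (congrArg _ h)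
    · have := hM a
      have := hN a
      exact iff_of_true trivial (iff_of_true (by omega) (by omega))
    · have := hM b
      have := hN b
      exact iff_of_true trivial (iff_of_false (by omega) (by omega))
    · have : (i : ℕ) ≠ j := fun h => hab (congrArg _ (Fin.ext h))
      simp only [false_iff]
      omega

theorem lexProduct [Finite β] (hG : Realizable G) (hH : Realizable H) :
    Realizable (lexProduct G H) := by
  obtain ⟨x, y, hx, hy, hG⟩ := hG
  obtain ⟨x', y', hx', hy', hH⟩ := hH
  have lex : ∀ M u v u' v' : ℕ, u' < M → v' < M → u ≠ v →
      (M * u + u' < M * v + v' ↔ u < v) := by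
    intro M u v u' v' hu hv huv
    rcases lt_or_gt_of_ne huv with h | h
    · have := Nat.mul_le_mul_left M (Nat.succ_le_of_lt h)
      rw [Nat.mul_succ] at this
      exact iff_of_true (by omega) h
    · have := Nat.mul_le_mul_left M (Nat.succ_le_of_lt h)
      rw [Nat.mul_succ] at this
      exact iff_of_false (by omega) (by omega)
  have inj : ∀ (M : ℕ) (f : α → ℕ) (g : β → ℕ), Function.Injective f → Function.Injective g →
      (∀ b, g b < M) → Function.Injective fun p : α × β => M * f p.1 + g p.2 := by
    rintro M f g hf hg hM ⟨a, b⟩ ⟨a', b'⟩ h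
    dsimp only at h
    have haa : a = a' := by
      by_contra hne
      have h1 := lex M _ _ _ _ (hM b) (hM b') (hf.ne hne)
      have h2 := lex M _ _ _ _ (hM b') (hM b) (hf.ne (Ne.symm hne))
      have := hf.ne hne
      omega
    subst haa
    rw [hg (by omega : g b = g b')]
  obtain ⟨M, hM⟩ := exists_forall_lt_of_finite x'
  obtain ⟨N, hN⟩ := exists_forall_lt_of_finite y'
  refine ⟨fun p => M * x p.1 + x' p.2, fun p => N * y p.1 + y' p.2, inj M x x' hx hx' hM,
    inj N y y' hy hy' hN, ?_⟩
  rintro ⟨a, b⟩ ⟨a', b'⟩ hne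
  by_cases haa : a = a'
  · subst haa
    have hbb : b ≠ b' := fun h => hne (by rw [h])
    simp [lexProduct_adj_same, hH b b' hbb]
  · rw [lexProduct_adj_of_ne haa, hG a a' haa, lex M _ _ _ _ (hM b) (hM b') (hx.ne haa),
      lex N _ _ _ _ (hN b) (hN b') (hy.ne haa)]

end Realizable

/-! ### A sharp permutation of length 15 -/

/-- The values of a permutation of length 15 that is critical for covers by two increasing and two
decreasing subsequences. -/
def baseValues : Fin 15 → ℕ := ![12, 9, 5, 14, 11, 10, 3, 7, 15, 2, 1, 6, 13, 4, 8]

/-- The graph of increasing pairs of `baseValues`. -/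
def baseGraph : SimpleGraph (Fin 15) where
  Adj i j := i ≠ j ∧ (i < j ↔ baseValues i < baseValues j)
  symm := ⟨by decide⟩
  loopless := ⟨by decide⟩

instance : DecidableRel baseGraph.Adj := fun i j =>
  inferInstanceAs (Decidable (i ≠ j ∧ (i < j ↔ baseValues i < baseValues j)))

theorem baseGraph_realizable : Realizable baseGraph := by
  refine ⟨fun i => i, baseValues, Fin.val_injective, ?_, fun a b hab => ?_⟩
  · unfold Function.Injective
    decide
  · simp [baseGraph, hab]

section TripleSearch

variable {V : Type*} (r s : V → V → Prop) [DecidableRel r] [DecidableRel s]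

/-- `v` forms a pairwise `r`-related triple with two entries of `l`. -/
def completesTriple (v : V) (l : List V) : Bool :=
  (l.filter (r v ·)).any fun a => (l.filter (r v ·)).any fun b => r a b

/-- Every distribution of the entries of the first list over the two other lists creates a pairwise
`r`-related triple in the first or a pairwise `s`-related triple in the second of them. -/
def forcesTriple : List V → List V → List V → Bool
  | [], _, _ => false
  | v :: vs, l, m =>
    (completesTriple r v l || forcesTriple vs (v :: l) m) &&
      (completesTriple s v m || forcesTriple vs l (v :: m))

variable {r s}

theorem exists_triple_of_completesTriple {v : V} {l : List V} (h : completesTriple r v l = true) :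
    ∃ a ∈ l, ∃ b ∈ l, r v a ∧ r v b ∧ r a b := by
  simp only [completesTriple, List.any_eq_true, List.mem_filter, decide_eq_true_eq] at h
  obtain ⟨a, ⟨ha, hva⟩, b, ⟨hb, hvb⟩, hab⟩ := h
  exact ⟨a, ha, b, hb, hva, hvb, hab⟩

theorem exists_triple_of_forcesTriple (f : V → Prop) (vs l m : List V)
    (hl : ∀ v ∈ l, f v) (hm : ∀ v ∈ m, ¬ f v) (h : forcesTriple r s vs l m = true) :
    (∃ u v w, f u ∧ f v ∧ f w ∧ r u v ∧ r u w ∧ r v w) ∨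
      ∃ u v w, ¬ f u ∧ ¬ f v ∧ ¬ f w ∧ s u v ∧ s u w ∧ s v w := by
  induction vs generalizing l m with
  | nil => simp [forcesTriple] at h
  | cons v vs ih =>
    simp only [forcesTriple, Bool.and_eq_true, Bool.or_eq_true] at h
    by_cases hv : f v
    · rcases h.1 with h | h
      · obtain ⟨a, ha, b, hb, h⟩ := exists_triple_of_completesTriple h
        exact Or.inl ⟨v, a, b, hv, hl a ha, hl b hb, h⟩
      · exact ih _ _ (by simpa [hv] using hl) hm h
    · rcases h.2 with h | h
      · obtain ⟨a, ha, b, hb, h⟩ := exists_triple_of_completesTriple h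
        exact Or.inr ⟨v, a, b, hv, hm a ha, hm b hb, h⟩
      · exact ih _ _ hl (by simpa [hv] using hm) h

end TripleSearch

theorem baseGraph_exists_triple (f : Fin 15 → Prop) :
    (∃ i j k, f i ∧ f j ∧ f k ∧ baseGraphᶜ.Adj i j ∧ baseGraphᶜ.Adj i k ∧ baseGraphᶜ.Adj j k) ∨
      ∃ i j k, ¬ f i ∧ ¬ f j ∧ ¬ f k ∧
        baseGraph.Adj i j ∧ baseGraph.Adj i k ∧ baseGraph.Adj j k :=
  exists_triple_of_forcesTriple f (List.finRange 15) [] [] (by simp) (by simp) (by decide +kernel)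

theorem baseGraph_exists_proper_coloring :
    ∃ c : Fin 15 → Fin 3, ∀ i j, c i = c j → ¬ baseGraph.Adj i j :=
  ⟨![0, 0, 0, 1, 1, 1, 0, 1, 2, 0, 0, 1, 2, 1, 2], by decide +kernel⟩

/-- The row of index `j` covers all positions but `j`: the colours 0 and 1 are increasing
subsequences, the colours 2 and 3 are decreasing ones. -/
def baseCovers : Fin 15 → Fin 15 → Fin (2 + 2) :=
  ![![0, 0, 1, 2, 0, 2, 2, 1, 3, 2, 2, 3, 0, 3, 1],
    ![0, 0, 1, 2, 2, 2, 2, 1, 3, 2, 2, 3, 0, 3, 1],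
    ![2, 0, 0, 0, 2, 2, 1, 2, 0, 2, 2, 1, 3, 3, 1],
    ![2, 0, 1, 0, 0, 2, 2, 1, 3, 2, 2, 3, 0, 3, 1],
    ![2, 2, 0, 3, 0, 0, 1, 2, 0, 2, 2, 1, 3, 3, 1],
    ![2, 2, 0, 3, 0, 0, 1, 2, 0, 2, 2, 1, 3, 3, 1],
    ![2, 0, 1, 0, 2, 2, 0, 2, 0, 2, 2, 1, 3, 3, 1],
    ![2, 0, 1, 0, 2, 2, 2, 0, 0, 2, 2, 1, 3, 3, 1],
    ![0, 2, 1, 3, 3, 3, 2, 1, 0, 2, 2, 3, 0, 3, 1],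
    ![2, 2, 2, 3, 3, 3, 0, 0, 0, 0, 1, 1, 1, 2, 3],
    ![2, 2, 2, 3, 3, 3, 0, 0, 0, 1, 0, 1, 1, 2, 3],
    ![2, 0, 1, 0, 2, 2, 2, 1, 0, 2, 2, 0, 3, 3, 1],
    ![0, 2, 1, 0, 3, 3, 2, 1, 0, 2, 2, 3, 0, 3, 1],
    ![2, 2, 0, 0, 3, 3, 1, 2, 0, 2, 2, 1, 1, 0, 3],
    ![0, 1, 2, 0, 1, 3, 2, 3, 0, 2, 2, 3, 1, 3, 0]]

theorem baseCovers_adj_iff : ∀ i j k : Fin 15,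
    j ≠ i ∧ k ≠ i ∧ j ≠ k ∧ baseCovers i j = baseCovers i k →
      (baseGraph.Adj j k ↔ (baseCovers i j : ℕ) < 2) := by
  decide +kernel

theorem baseGraph_exists_cover (i : Fin 15) :
    ∃ c : Fin 15 → Fin 2 ⊕ Fin 2, ∀ j k, j ≠ i → k ≠ i → j ≠ k → c j = c k →
      (baseGraph.Adj j k ↔ (c j).isLeft = true) := by
  have isLeft_iff : ∀ a : Fin (2 + 2), (finSumFinEquiv.symm a).isLeft = true ↔ (a : ℕ) < 2 := by
    decide
  refine ⟨fun j => finSumFinEquiv.symm (baseCovers i j), fun j k hj hk hjk h => ?_⟩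
  rw [isLeft_iff]
  exact baseCovers_adj_iff i j k ⟨hj, hk, hjk, finSumFinEquiv.symm.injective h⟩

/-! ### Sharp graphs -/

/-- `G` is critical for covers by `ν` cliques and `ν` independent sets, and it can be covered by
`ν + 1` independent sets. -/
structure IsSharp {α : Type*} (G : SimpleGraph α) (ν : ℕ) : Prop where
  not_splitColorable : ¬ SplitColorable G (Fin ν) (Fin ν)
  exists_proper_coloring : ∃ c : α → Option (Fin ν), ∀ x y, c x = c y → ¬ G.Adj x y
  splitColorable_induce : ∀ x, SplitColorable (G.induce {x}ᶜ) (Fin ν) (Fin ν)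

theorem isSharp_bot_unit : IsSharp (⊥ : SimpleGraph Unit) 0 where
  not_splitColorable := fun ⟨c, _⟩ => isEmptyElim (c ())
  exists_proper_coloring := ⟨fun _ => none, fun _ _ _ => id⟩
  splitColorable_induce := fun _ => ⟨fun y => (y.2 rfl).elim, fun y => (y.2 rfl).elim⟩

theorem card_union_of_three {γ : Type*} [Fintype γ] [DecidableEq γ] {A B C : Finset γ} {n : ℕ}
    (hA : n ≤ A.card) (hB : n ≤ B.card) (hC : n ≤ C.card) (hAB : Disjoint A B)
    (hAC : Disjoint A C) (hBC : Disjoint B C) : 3 * n ≤ Fintype.card γ := by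
  have h := Finset.card_le_univ (A ∪ B ∪ C)
  rw [Finset.card_union_of_disjoint (Finset.disjoint_union_left.2 ⟨hAC, hBC⟩),
    Finset.card_union_of_disjoint hAB] at h
  omega

theorem IsSharp.not_splitColorable_lexProduct {β : Type*} {H : SimpleGraph β} {ν : ℕ}
    (hH : IsSharp H ν) :
    ¬ SplitColorable (lexProduct baseGraph H) (Fin (3 * ν + 2)) (Fin (3 * ν + 2)) := by
  classical
  rintro ⟨c, hc⟩
  let A : Fin 15 → Finset (Fin (3 * ν + 2)) := fun i => {a | ∃ y, c (i, y) = Sum.inl a}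
  let B : Fin 15 → Finset (Fin (3 * ν + 2)) := fun i => {b | ∃ y, c (i, y) = Sum.inr b}
  have hAB : ∀ i, ¬ ν + 1 ≤ (A i).card → ν + 1 ≤ (B i).card := by
    intro i hA
    by_contra hB
    have h : SplitColorable H (A i) (B i) :=
      SplitColorable.of_finsets (c := fun y => c (i, y))
        (fun x y hxy hcxy => by
          rw [← lexProduct_adj_same (G := baseGraph) i]
          exact hc _ _ (by simpa using hxy) hcxy) (A i) (B i)
        (fun x a h => Finset.mem_filter.2 ⟨Finset.mem_univ _, x, h⟩)
        (fun x b h => Finset.mem_filter.2 ⟨Finset.mem_univ _, x, h⟩)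
    exact hH.not_splitColorable (h.of_card_le (by simp; omega) (by simp; omega))
  have hA : ∀ i j, baseGraphᶜ.Adj i j → Disjoint (A i) (A j) := by
    intro i j hij
    rw [SimpleGraph.compl_adj] at hij
    refine Finset.disjoint_left.2 fun a hi hj => ?_
    obtain ⟨-, x, hx⟩ := Finset.mem_filter.1 hi
    obtain ⟨-, y, hy⟩ := Finset.mem_filter.1 hj
    have := hc (i, x) (j, y) (fun h => hij.1 (congrArg Prod.fst h)) (hx.trans hy.symm)
    rw [lexProduct_adj_of_ne hij.1, hx] at this
    exact hij.2 (this.2 rfl)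
  have hB : ∀ i j, baseGraph.Adj i j → Disjoint (B i) (B j) := by
    intro i j hij
    refine Finset.disjoint_left.2 fun a hi hj => ?_
    obtain ⟨-, x, hx⟩ := Finset.mem_filter.1 hi
    obtain ⟨-, y, hy⟩ := Finset.mem_filter.1 hj
    have := hc (i, x) (j, y) (fun h => hij.ne (congrArg Prod.fst h)) (hx.trans hy.symm)
    rw [lexProduct_adj_of_ne hij.ne, hx] at this
    exact Bool.false_ne_true (this.1 hij)
  rcases baseGraph_exists_triple fun i => ν + 1 ≤ (A i).card with
    ⟨i, j, k, hi, hj, hk, hij, hik, hjk⟩ | ⟨i, j, k, hi, hj, hk, hij, hik, hjk⟩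
  · have := card_union_of_three hi hj hk (hA _ _ hij) (hA _ _ hik) (hA _ _ hjk)
    rw [Fintype.card_fin] at this
    omega
  · have := card_union_of_three (hAB i hi) (hAB j hj) (hAB k hk) (hB _ _ hij) (hB _ _ hik)
      (hB _ _ hjk)
    rw [Fintype.card_fin] at this
    omega

theorem IsSharp.exists_proper_coloring_lexProduct {β : Type*} {H : SimpleGraph β} {ν : ℕ}
    (hH : IsSharp H ν) : ∃ c : Fin 15 × β → Option (Fin (3 * ν + 2)),
      ∀ x y, c x = c y → ¬ (lexProduct baseGraph H).Adj x y := by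
  obtain ⟨b, hb⟩ := baseGraph_exists_proper_coloring
  obtain ⟨e, he⟩ := hH.exists_proper_coloring
  have g : Fin 3 × Option (Fin ν) ≃ Option (Fin (3 * ν + 2)) :=
    Fintype.equivOfCardEq (by simp; ring)
  refine ⟨fun p => g (b p.1, e p.2), ?_⟩
  rintro ⟨i, x⟩ ⟨j, y⟩ h
  have h := g.injective h
  simp only [Prod.mk.injEq] at h
  rintro (hij | ⟨-, hxy⟩)
  · exact hb i j h.1 hij
  · exact he x y h.2 hxy

theorem IsSharp.splitColorable_induce_lexProduct {β : Type*} {H : SimpleGraph β} {ν : ℕ}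
    (hH : IsSharp H ν) (p : Fin 15 × β) :
    SplitColorable ((lexProduct baseGraph H).induce {p}ᶜ)
      (Fin (3 * ν + 2)) (Fin (3 * ν + 2)) := by
  classical
  obtain ⟨i₀, x₀⟩ := p
  obtain ⟨b, hb⟩ := baseGraph_exists_proper_coloring
  obtain ⟨c, hc⟩ := baseGraph_exists_cover i₀
  obtain ⟨e, he⟩ := hH.exists_proper_coloring
  obtain ⟨d, hd⟩ := hH.splitColorable_induce x₀
  obtain ⟨d', hd'⟩ := (hH.splitColorable_induce x₀).of_induce_compl_singleton
  -- The independent sets indexed by `Fin 3 × Fin ν` are shared by all blocks.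
  let dec : Fin 15 → Fin ν → (Fin ν ⊕ Fin 2 × Option (Fin ν)) ⊕ (Fin 3 × Fin ν ⊕ Fin 2) :=
    fun i t => Sum.inr (Sum.inl (b i, t))
  let f : ({(i₀, x₀)}ᶜ : Set (Fin 15 × β)) →
      (Fin ν ⊕ Fin 2 × Option (Fin ν)) ⊕ (Fin 3 × Fin ν ⊕ Fin 2) := fun q =>
    if h : q.1.1 = i₀ then
      (d ⟨q.1.2, fun h' => q.2 (Prod.ext h h')⟩).elim (fun a => Sum.inl (Sum.inl a)) (dec q.1.1)
    else
      (c q.1.1).elim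
        (fun u => (d' q.1.2).elim (fun a => Sum.inl (Sum.inr (u, a))) (dec q.1.1))
        (fun u => (e q.1.2).elim (Sum.inr (Sum.inr u)) (dec q.1.1))
  have hf : SplitColorable ((lexProduct baseGraph H).induce {(i₀, x₀)}ᶜ)
      (Fin ν ⊕ Fin 2 × Option (Fin ν)) (Fin 3 × Fin ν ⊕ Fin 2) := by
    refine ⟨f, ?_⟩
    rintro ⟨⟨i, x⟩, hix⟩ ⟨⟨j, y⟩, hjy⟩ hne hcol
    rw [SimpleGraph.induce_adj]
    dsimp only [f, dec] at hcol ⊢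
    by_cases hij : i = j
    · subst hij
      have hxy : x ≠ y := fun h => hne (by simp [h])
      rw [lexProduct_adj_same]
      by_cases hi : i = i₀
      · simp only [hi, dite_true] at hcol ⊢
        have hx : x ∈ ({x₀}ᶜ : Set β) := fun h => hix (Prod.ext hi h)
        have hy : y ∈ ({x₀}ᶜ : Set β) := fun h => hjy (Prod.ext hi h)
        have := hd ⟨x, hx⟩ ⟨y, hy⟩ (by simpa using hxy)
        rw [SimpleGraph.induce_adj] at this
        rcases h : d ⟨x, hx⟩ with a | a <;> rcases h' : d ⟨y, hy⟩ with a' | a' <;>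
          simp_all
      · simp only [hi, dite_false] at hcol ⊢
        rcases hci : c i with u | u
        · have := hd' x y hxy
          rcases h : d' x with a | a <;> rcases h' : d' y with a' | a' <;> simp_all
        · have := he x y
          rcases h : e x with _ | a <;> rcases h' : e y with _ | a' <;> simp_all
    · rw [lexProduct_adj_of_ne hij]
      have hbij := hb i j
      by_cases hi : i = i₀
      · have hj : j ≠ i₀ := fun h => hij (hi.trans h.symm)
        simp only [hi, hj, dite_true, dite_false] at hcol ⊢
        subst hi
        rcases h : d ⟨x, fun h' => hix (Prod.ext rfl h')⟩ with a | a <;>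
          rcases hcj : c j with u | u <;> simp only [h, hcj, Sum.elim_inl, Sum.elim_inr] at hcol ⊢
        · rcases h' : d' y with a' | a' <;> simp [h'] at hcol
        · rcases h' : e y with _ | a' <;> simp [h'] at hcol
        · rcases h' : d' y with a' | a' <;> simp [h'] at hcol
          simpa using hbij hcol.1
        · rcases h' : e y with _ | a' <;> simp [h'] at hcol
          simpa using hbij hcol.1
      · by_cases hj : j = i₀
        · simp only [hi, hj, dite_true, dite_false] at hcol ⊢
          subst hj
          rcases h : d ⟨y, fun h' => hjy (Prod.ext rfl h')⟩ with a | a <;>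
            rcases hci : c i with u | u <;> simp only [h, hci, Sum.elim_inl, Sum.elim_inr] at hcol ⊢
          · rcases h' : d' x with a' | a' <;> simp [h'] at hcol
          · rcases h' : e x with _ | a' <;> simp [h'] at hcol
          · rcases h' : d' x with a' | a' <;> simp [h'] at hcol
            simpa using hbij hcol.1
          · rcases h' : e x with _ | a' <;> simp [h'] at hcol
            simpa using hbij hcol.1
        · simp only [hi, hj, dite_false] at hcol ⊢
          have := hc i j hi hj hij
          rcases hci : c i with u | u <;> rcases hcj : c j with v | v <;>
            simp only [hci, hcj, Sum.elim_inl, Sum.elim_inr] at hcol this ⊢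
          · rcases h : d' x with a | a <;> rcases h' : d' y with a' | a' <;>
              simp [h, h'] at hcol ⊢
            · simpa using this (congrArg _ hcol.1)
            · exact hbij hcol.1
          · rcases h : d' x with a | a <;> rcases h' : e y with _ | a' <;>
              simp [h, h'] at hcol ⊢
            exact hbij hcol.1
          · rcases h : e x with _ | a <;> rcases h' : d' y with a' | a' <;>
              simp [h, h'] at hcol ⊢
            exact hbij hcol.1
          · rcases h : e x with _ | a <;> rcases h' : e y with _ | a' <;>
              simp [h, h'] at hcol ⊢
            · simpa using this (congrArg _ hcol)
            · exact hbij hcol.1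
  exact hf.of_card_le (by simp; omega) (by simp)

theorem IsSharp.lexProduct {β : Type*} {H : SimpleGraph β} {ν : ℕ} (hH : IsSharp H ν) :
    IsSharp (lexProduct baseGraph H) (3 * ν + 2) :=
  ⟨hH.not_splitColorable_lexProduct, hH.exists_proper_coloring_lexProduct,
    hH.splitColorable_induce_lexProduct⟩

theorem exists_isSharp (t : ℕ) : ∃ (α : Type) (_ : Fintype α) (G : SimpleGraph α) (ν : ℕ),
    Realizable G ∧ IsSharp G ν ∧ Fintype.card α = 15 ^ t ∧ ν + 1 = 3 ^ t := by
  induction t with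
  | zero =>
    exact ⟨Unit, inferInstance, ⊥, 0, ⟨fun _ => 0, fun _ => 0, fun _ _ _ => rfl, fun _ _ _ => rfl,
      fun _ _ h => (h rfl).elim⟩, isSharp_bot_unit, by simp, by simp⟩
  | succ t ih =>
    obtain ⟨α, _, G, ν, hG, hν, hcard, ht⟩ := ih
    refine ⟨Fin 15 × α, inferInstance, _, _, baseGraph_realizable.lexProduct hG, hν.lexProduct,
      ?_, ?_⟩
    · simp [hcard, pow_succ, mul_comm]
    · rw [pow_succ]
      omega

/-! ### From one pair to all pairs with the same sum -/

theorem splitColorable_of_joinEmpty {α : Type*} {G : SimpleGraph α} {ℓ i j : ℕ} (hi : i < ℓ)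
    (h : SplitColorable (joinEmpty G (Fin ℓ)) (Fin i) (Fin j)) :
    ∃ j', j = j' + 1 ∧ SplitColorable G (Fin i) (Fin j') := by
  classical
  obtain ⟨c, hc⟩ := h
  have hb : ∃ (y : Fin ℓ) (b : Fin j), c (Sum.inr y) = Sum.inr b := by
    by_contra hcon
    have : ∀ y, ∃ a, c (Sum.inr y) = Sum.inl a := by
      intro y
      rcases hy : c (Sum.inr y) with a | b
      · exact ⟨a, rfl⟩
      · exact (hcon ⟨y, b, hy⟩).elim
    choose g hg using this
    obtain ⟨y, z, hyz, hgyz⟩ := Fintype.exists_ne_map_eq_of_card_lt g (by simpa using hi)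
    have := hc (Sum.inr y) (Sum.inr z) (by simpa using hyz) (by rw [hg, hg, hgyz])
    rw [hg] at this
    exact this.2 rfl
  obtain ⟨y, b, hy⟩ := hb
  obtain ⟨j', rfl⟩ : ∃ j', j = j' + 1 := Nat.exists_eq_add_one.2 b.pos
  refine ⟨j', rfl, ?_⟩
  have h : SplitColorable G (Finset.univ : Finset (Fin i)) ({b}ᶜ : Finset (Fin (j' + 1))) := by
    refine SplitColorable.of_finsets (c := fun x => c (Sum.inl x))
      (fun x z hxz hcxz => hc (Sum.inl x) (Sum.inl z) (by simpa using hxz) hcxz) _ _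
      (fun _ _ _ => Finset.mem_univ _) fun x b' hx => ?_
    rw [Finset.mem_compl, Finset.mem_singleton]
    rintro rfl
    have := hc (Sum.inl x) (Sum.inr y) (by simp) (hx.trans hy.symm)
    rw [hx] at this
    exact Bool.false_ne_true (this.1 trivial)
  exact h.of_card_le (by simp) (by simp)

/-- The embedding of `G` into its join with an edgeless graph. -/
def joinEmptyInl {α : Type*} (G : SimpleGraph α) (β : Type*) : G ↪g joinEmpty G β where
  toFun := Sum.inl
  inj' := Sum.inl_injective
  map_rel_iff' := Iff.rfl

theorem splitColorable_induce_joinEmpty {α : Type*} {G : SimpleGraph α} {ρ κ κ' : Type*} {ℓ : ℕ}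
    {x : α} (h : SplitColorable (G.induce {x}ᶜ) ρ κ) (f : κ ↪ κ') (g : Fin ℓ → ρ ⊕ κ')
    (hg : ∀ y z, y ≠ z → g y = g z → (g y).isRight = true)
    (hfg : ∀ y u, g y ≠ Sum.inr (f u)) :
    SplitColorable ((joinEmpty G (Fin ℓ)).induce {Sum.inl x}ᶜ) ρ κ' := by
  obtain ⟨c, hc⟩ := h
  let F : ({Sum.inl x}ᶜ : Set (α ⊕ Fin ℓ)) → ρ ⊕ κ' := fun q =>
    match q with
    | ⟨Sum.inl a, ha⟩ => Sum.map id f (c ⟨a, fun h => ha (congrArg Sum.inl h)⟩)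
    | ⟨Sum.inr y, _⟩ => g y
  refine ⟨F, ?_⟩
  rintro ⟨a | y, ha⟩ ⟨b | z, hb⟩ hne hcol <;> rw [SimpleGraph.induce_adj] <;>
    dsimp only [F, joinEmpty] at hcol ⊢
  · have := hc ⟨a, fun h => ha (congrArg Sum.inl h)⟩ ⟨b, fun h => hb (congrArg Sum.inl h)⟩
      (by simpa using hne)
      (Sum.map_injective.2 ⟨Function.injective_id, f.injective⟩ hcol)
    rw [SimpleGraph.induce_adj] at this
    rw [this]
    cases c ⟨a, fun h => ha (congrArg Sum.inl h)⟩ <;> simp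
  · rcases h : c ⟨a, fun h => ha (congrArg Sum.inl h)⟩ with u | u
    · simp
    · rw [h] at hcol
      exact (hfg z u hcol.symm).elim
  · rw [hcol]
    rcases h : c ⟨b, fun h => hb (congrArg Sum.inl h)⟩ with u | u
    · simp
    · rw [h] at hcol
      exact (hfg y u hcol).elim
  · have := hg y z (by simpa using hne) hcol
    cases h : g y <;> simp_all

/-- Some realizable graph admits no cover by `i` cliques and `j` independent sets for `(i, j)` in
`D`, but has `n` vertices each of whose deletion leaves a graph that has a cover by `r` cliques and
`s` independent sets. -/
def HasCore (n : ℕ) (D : ℕ → ℕ → Prop) (r s : ℕ) : Prop :=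
  ∃ (α : Type) (_ : Fintype α) (G : SimpleGraph α) (core : Finset α), Realizable G ∧
    core.card = n ∧ (∀ i j, D i j → ¬ SplitColorable G (Fin i) (Fin j)) ∧
    ∀ x ∈ core, SplitColorable (G.induce {x}ᶜ) (Fin r) (Fin s)

namespace HasCore

variable {n r s : ℕ} {D D' : ℕ → ℕ → Prop}

theorem mono (h : HasCore n D r s) (hD : ∀ i j, D' i j → D i j) : HasCore n D' r s := by
  obtain ⟨α, hα, G, core, hG, hn, hcov, hcore⟩ := h
  exact ⟨α, hα, G, core, hG, hn, fun i j hij => hcov i j (hD i j hij), hcore⟩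

theorem swap (h : HasCore n D r s) : HasCore n (fun i j => D j i) s r := by
  obtain ⟨α, hα, G, core, hG, hn, hcov, hcore⟩ := h
  refine ⟨α, hα, Gᶜ, core, hG.compl, hn, fun i j hij hc => hcov j i hij ?_, fun x hx => ?_⟩
  · simpa using hc.compl
  · refine (hcore x hx).compl.of_embedding ⟨Function.Embedding.refl _, ?_⟩
    intro a b
    simp [SimpleGraph.compl_adj, Subtype.ext_iff]

theorem joinEmpty_aux (h : HasCore n D r s) {ℓ s' : ℕ} (f : Fin s ↪ Fin s')
    (g : Fin ℓ → Fin r ⊕ Fin s') (hg : ∀ y z, y ≠ z → g y = g z → (g y).isRight = true)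
    (hfg : ∀ y u, g y ≠ Sum.inr (f u))
    (hlt : ∀ i j, i < ℓ → D' i (j + 1) → D i j) (hge : ∀ i j, ℓ ≤ i → D' i j → D i j) :
    HasCore n D' r s' := by
  obtain ⟨α, hα, G, core, hG, hn, hcov, hcore⟩ := h
  refine ⟨α ⊕ Fin ℓ, inferInstance, joinEmpty G (Fin ℓ), core.map Function.Embedding.inl,
    hG.joinEmpty ℓ, by simpa using hn, fun i j hij hc => ?_, fun x hx => ?_⟩
  · rcases lt_or_ge i ℓ with hi | hi
    · obtain ⟨j', rfl, hc'⟩ := splitColorable_of_joinEmpty hi hc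
      exact hcov i j' (hlt i j' hi hij) hc'
    · exact hcov i j (hge i j hi hij) (hc.of_embedding (joinEmptyInl G _))
  · obtain ⟨x', hx', rfl⟩ := Finset.mem_map.1 hx
    exact splitColorable_induce_joinEmpty (hcore x' hx') f g hg hfg

theorem joinEmpty_of_le (h : HasCore n D r s) {ℓ : ℕ} (hℓ : ℓ ≤ r)
    (hlt : ∀ i j, i < ℓ → D' i (j + 1) → D i j) (hge : ∀ i j, ℓ ≤ i → D' i j → D i j) :
    HasCore n D' r s :=
  h.joinEmpty_aux (Function.Embedding.refl _) (fun y => Sum.inl (Fin.castLE hℓ y))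
    (fun _ _ hyz h => (hyz (Fin.castLE_injective hℓ (Sum.inl_injective h))).elim)
    (fun _ _ => Sum.inl_ne_inr) hlt hge

theorem joinEmpty_succ (h : HasCore n D r s) (ℓ : ℕ)
    (hlt : ∀ i j, i < ℓ → D' i (j + 1) → D i j) (hge : ∀ i j, ℓ ≤ i → D' i j → D i j) :
    HasCore n D' r (s + 1) :=
  h.joinEmpty_aux Fin.castSuccEmb (fun _ => Sum.inr (Fin.last s)) (fun _ _ _ _ => rfl)
    (fun _ u h => (Fin.castSucc_lt_last u).ne (Sum.inr_injective h).symm) hlt hge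

theorem triangle {ν : ℕ} (h : HasCore n (fun i j => i ≤ ν ∧ j ≤ ν) ν ν) :
    HasCore n (fun i j => i + j ≤ ν + ν) ν ν := by
  have rows : ∀ t ≤ ν, HasCore n (fun i j => i ≤ ν ∧ j ≤ ν + (t - i)) ν ν := by
    intro t ht
    induction t with
    | zero => exact h.mono fun i j => by omega
    | succ t ih =>
      exact (ih (by omega)).joinEmpty_of_le ht (fun i j => by omega) (fun i j => by omega)
  have columns : ∀ t ≤ ν, HasCore n (fun i j => i + j ≤ ν + ν ∧ j ≤ ν + (t - i)) ν ν := by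
    intro t ht
    induction t with
    | zero => exact (rows ν le_rfl).swap.mono fun i j => by omega
    | succ t ih =>
      exact (ih (by omega)).joinEmpty_of_le ht (fun i j => by omega) (fun i j => by omega)
  exact (columns ν le_rfl).mono fun i j => by omega

theorem triangle_add {k : ℕ} (h : HasCore n (fun i j => i + j ≤ k) r s) (d : ℕ) :
    HasCore n (fun i j => i + j ≤ k + d) r (s + d) := by
  induction d with
  | zero => exact h
  | succ d ih =>
    exact ih.joinEmpty_succ (k + d + 2) (fun i j => by omega) (fun i j => by omega)

end HasCore

theorem IsSharp.hasCore {α : Type} [Fintype α] {G : SimpleGraph α} {ν : ℕ} (h : IsSharp G ν)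
    (hG : Realizable G) : HasCore (Fintype.card α) (fun i j => i ≤ ν ∧ j ≤ ν) ν ν :=
  ⟨α, inferInstance, G, Finset.univ, hG, rfl,
    fun _ _ hij hc => h.not_splitColorable (hc.mono hij.1 hij.2),
    fun x _ => h.splitColorable_induce x⟩

/-! ### Permutations -/

/-- The graph of increasing pairs of a permutation. -/
def increasingGraph {n : ℕ} (π : Equiv.Perm (Fin n)) : SimpleGraph (Fin n) where
  Adj i j := i ≠ j ∧ (i < j ↔ π i < π j)
  symm := ⟨fun i j h => ⟨h.1.symm, by
    have := h.1
    have := π.injective.ne h.1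
    have := h.2
    omega⟩⟩
  loopless := ⟨fun _ h => h.1 rfl⟩

theorem coverable_iff {n : ℕ} (π : Equiv.Perm (Fin n)) (r s : ℕ) :
    Coverable π r s ↔ SplitColorable (increasingGraph π) (Fin r) (Fin s) := by
  constructor
  · rintro ⟨c, hinc, hdec⟩
    refine ⟨c, fun x y hxy hc => ?_⟩
    rcases h : c x with a | b
    · have hx : x ∈ {i | c i = Sum.inl a} := h
      have hy : y ∈ {i | c i = Sum.inl a} := hc.symm.trans h
      have h₁ := hinc a x hx y hy
      have h₂ := hinc a y hy x hx
      simp only [increasingGraph, Sum.isLeft_inl, iff_true]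
      exact ⟨hxy, by omega⟩
    · have hx : x ∈ {i | c i = Sum.inr b} := h
      have hy : y ∈ {i | c i = Sum.inr b} := hc.symm.trans h
      have h₁ := hdec b x hx y hy
      have h₂ := hdec b y hy x hx
      simp only [increasingGraph, Sum.isLeft_inr, Bool.false_eq_true, iff_false]
      rintro ⟨-, h₃⟩
      omega
  · rintro ⟨c, hc⟩
    refine ⟨c, fun a i hi j hj hij => ?_, fun b i hi j hj hij => ?_⟩
    · have := hc i j hij.ne (Eq.trans hi (Eq.symm hj))
      rw [show c i = _ from hi] at this
      exact (this.2 rfl).2.1 hij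
    · have := hc i j hij.ne (Eq.trans hi (Eq.symm hj))
      rw [show c i = _ from hi] at this
      by_contra hle
      have hne := π.injective.ne hij.ne
      exact Bool.false_ne_true (this.1 ⟨hij.ne, iff_of_true hij (by omega)⟩)

theorem Pattern.nonempty_embedding {m n : ℕ} {τ : Equiv.Perm (Fin m)} {π : Equiv.Perm (Fin n)}
    (h : Pattern τ π) : Nonempty (increasingGraph τ ↪g increasingGraph π) := by
  obtain ⟨f, hf, hτ⟩ := h
  refine ⟨⟨⟨f, hf.injective⟩, fun {i j} => ?_⟩⟩
  simp [increasingGraph, hf.lt_iff_lt, hf.injective.eq_iff, hτ]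

theorem exists_equiv_strictMono {α : Type*} [Fintype α] {x : α → ℕ} (hx : Function.Injective x) :
    ∃ e : Fin (Fintype.card α) ≃ α, StrictMono (x ∘ e) := by
  let _ : LinearOrder α := LinearOrder.lift' x hx
  let e := monoEquivOfFin α rfl
  exact ⟨e.toEquiv, fun _ _ hij => e.strictMono hij⟩

theorem Realizable.exists_perm {α : Type*} [Fintype α] {G : SimpleGraph α} (h : Realizable G) :
    ∃ π : Equiv.Perm (Fin (Fintype.card α)), Nonempty (increasingGraph π ≃g G) := by
  obtain ⟨x, y, hx, hy, hG⟩ := h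
  obtain ⟨e, he⟩ := exists_equiv_strictMono hx
  obtain ⟨e', he'⟩ := exists_equiv_strictMono hy
  refine ⟨e.trans e'.symm, ⟨⟨e, fun {i j} => ?_⟩⟩⟩
  by_cases hij : i = j
  · simp [hij]
  · rw [hG _ _ (e.injective.ne hij)]
    have h₁ : x (e i) < x (e j) ↔ i < j := he.lt_iff_lt
    have h₂ : y (e i) < y (e j) ↔ e'.symm (e i) < e'.symm (e j) := by
      simpa using he'.lt_iff_lt (a := e'.symm (e i)) (b := e'.symm (e j))
    simp [increasingGraph, hij, h₁, h₂]

theorem HasCore.exists_kCritical {n r s k : ℕ} (h : HasCore n (fun i j => i + j ≤ k) r s)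
    (hk : r + s = k) : ∃ (m : ℕ) (π : Equiv.Perm (Fin m)), KCritical π k ∧ n ≤ m := by
  classical
  obtain ⟨α, _, G, core, hG, hn, hcov, hcore⟩ := h
  have hex : ∃ m, ∃ τ : Equiv.Perm (Fin m),
      ¬ KCoverable τ k ∧ Nonempty (increasingGraph τ ↪g G) := by
    obtain ⟨π, ⟨φ⟩⟩ := hG.exists_perm
    refine ⟨_, π, ?_, ⟨φ.toEmbedding⟩⟩
    rintro ⟨i, j, hij, hc⟩
    exact hcov i j hij.le (((coverable_iff π i j).1 hc).of_embedding φ.symm.toEmbedding)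
  obtain ⟨τ, hτ, ⟨φ⟩⟩ := Nat.find_spec hex
  refine ⟨_, τ, ⟨hτ, fun m σ hσ => ?_⟩, ?_⟩
  · by_contra hcon
    obtain ⟨ψ⟩ := hσ.2.nonempty_embedding
    exact Nat.find_min hex hσ.1 ⟨σ, hcon, ⟨φ.comp ψ⟩⟩
  · have hsub : core ⊆ Finset.univ.map φ.toEmbedding := by
      intro x hx
      by_contra hxφ
      have hmem : ∀ i, φ i ∈ ({x}ᶜ : Set α) := fun i hi =>
        hxφ (Finset.mem_map.2 ⟨i, Finset.mem_univ _, hi⟩)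
      let ψ : increasingGraph τ ↪g G.induce {x}ᶜ :=
        ⟨⟨fun i => ⟨φ i, hmem i⟩, fun i j hij => φ.injective (congrArg Subtype.val hij)⟩,
          φ.map_adj_iff⟩
      exact hτ ⟨r, s, hk, (coverable_iff τ r s).2 ((hcore x hx).of_embedding ψ)⟩
    have := Finset.card_le_card hsub
    rw [Finset.card_map, Finset.card_univ, Fintype.card_fin] at this
    omega

theorem rpow_three_pow_le (t : ℕ) : ((3 : ℝ) ^ t) ^ (2.46 : ℝ) ≤ 15 ^ t := by
  have h : (3 : ℝ) ^ (2.46 : ℝ) ≤ 15 := by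
    refine le_of_pow_le_pow_left₀ (n := 50) (by norm_num) (by norm_num) ?_
    rw [← Real.rpow_natCast, ← Real.rpow_mul (by norm_num)]
    have : (2.46 : ℝ) * ((50 : ℕ) : ℝ) = ((123 : ℕ) : ℝ) := by norm_num
    rw [this, Real.rpow_natCast]
    norm_num
  rw [← Real.rpow_natCast_mul (by norm_num), mul_comm, Real.rpow_mul_natCast (by norm_num)]
  exact pow_le_pow_left₀ (by positivity) h t

/-- For every `k ≥ 1` there is a `k`-critical permutation of length at least `(k/6)^2.46`. -/
theorem long_critical (k : ℕ) (hk : 1 ≤ k) :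
    ∃ (m : ℕ) (π : Equiv.Perm (Fin m)),
      KCritical π k ∧ ((k : ℝ) / 6) ^ (2.46 : ℝ) ≤ (m : ℝ) := by
  obtain ⟨t, ht, ht'⟩ : ∃ t, 3 ^ t ≤ (k + 2) / 2 ∧ (k + 2) / 2 < 3 ^ (t + 1) :=
    ⟨Nat.log 3 ((k + 2) / 2), Nat.pow_log_le_self 3 (by omega),
      Nat.lt_pow_succ_log_self (by norm_num) _⟩
  obtain ⟨α, _, G, ν, hG, hν, hcard, hνt⟩ := exists_isSharp t
  obtain ⟨d, rfl⟩ : ∃ d, k = ν + ν + d := Nat.exists_eq_add_of_le (by omega)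
  obtain ⟨m, π, hπ, hm⟩ :=
    ((hν.hasCore hG).triangle.triangle_add d).exists_kCritical (by omega)
  refine ⟨m, π, hπ, ?_⟩
  have hle : ((ν + ν + d : ℕ) : ℝ) / 6 ≤ 3 ^ t := by
    rw [div_le_iff₀ (by norm_num)]
    have : ν + ν + d ≤ 3 ^ t * 6 := by
      rw [pow_succ] at ht'
      omega
    exact_mod_cast this
  calc (((ν + ν + d : ℕ) : ℝ) / 6) ^ (2.46 : ℝ) ≤ ((3 : ℝ) ^ t) ^ (2.46 : ℝ) :=
        Real.rpow_le_rpow (by positivity) hle (by norm_num)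
    _ ≤ 15 ^ t := rpow_three_pow_le t
    _ ≤ m := by
      rw [hcard] at hm
      exact_mod_cast hm
end

section
/- Fix r, d ∈ ℕ with r ≥ 2 and let U be a nonempty finite set. Suppose for every i ∈ U we have a function P_i : U \ {i} → {1,2}, and suppose the P_i are pairwise close in the sense that for any i, j ∈ U there are at most d points k ∈ U \ {i,j} with P_i(k) ≠ P_j(k). If |U| > min(4·r^{d+1}, (4r)^{d/2+1}) (real exponentiation), then there exists a function P : U → {1,2} such that for every S ⊆ U of size at most r+1 there exists i ∈ U \ S with P(k) = P_i(k) for all k ∈ S. -/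
namespace CloseFunctions

open Finset

variable {α : Type*} [DecidableEq α] {P : α → α → Fin 2}

/-- If every function indexed by `B \ R` disagrees with `Q` somewhere on the small set `R`,
then many of them disagree with `Q` at the same point of `R`. -/
lemma exists_popular_disagreement {Q : α → Fin 2} {B R : Finset α} {m c : ℕ} (hR : #R ≤ m)
    (hhit : ∀ b ∈ B, b ∉ R → ∃ k ∈ R, Q k ≠ P b k) (hB : m * (c + 1) < #B) :
    ∃ k ∈ R, c < #{b ∈ B | k ≠ b ∧ Q k ≠ P b k} := by
  by_contra! hfew
  have hsub : B ⊆ R ∪ R.biUnion fun k => {b ∈ B | k ≠ b ∧ Q k ≠ P b k} := by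
    intro b hb
    by_cases hbR : b ∈ R
    · exact mem_union_left _ hbR
    · obtain ⟨k, hk, hne⟩ := hhit b hb hbR
      refine mem_union_right _ (mem_biUnion.2 ⟨k, hk, mem_filter.2 ⟨hb, ?_, hne⟩⟩)
      rintro rfl
      exact hbR hk
  have hcard := (card_le_card hsub).trans (card_union_le _ _)
  have hunion := card_biUnion_le_card_mul R _ c hfew
  nlinarith

lemma exists_majority_value (P : α → α → Fin 2) (A : Finset α) (k : α) :
    ∃ v, #A ≤ 2 * #{a ∈ A | k ≠ a ∧ P a k = v} + 1 := by
  by_contra! hfew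
  have hsub : A ⊆ insert k ({a ∈ A | k ≠ a ∧ P a k = 0} ∪ {a ∈ A | k ≠ a ∧ P a k = 1}) := by
    intro a ha
    have hval : P a k = 0 ∨ P a k = 1 := by omega
    simp only [mem_insert, mem_union, mem_filter]
    grind
  have hcard := card_le_card hsub
  have hinsert := card_insert_le k
    ({a ∈ A | k ≠ a ∧ P a k = 0} ∪ {a ∈ A | k ≠ a ∧ P a k = 1})
  have hunion := card_union_le {a ∈ A | k ≠ a ∧ P a k = 0} {a ∈ A | k ≠ a ∧ P a k = 1}
  have h0 := hfew 0
  have h1 := hfew 1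
  omega

/-- Every `Q` is defeated by a set `S` of at most `r + 1` points. -/
def AllDefeated (P : α → α → Fin 2) (r : ℕ) : Prop :=
  ∀ Q : α → Fin 2, ∃ S : Finset α, #S ≤ r + 1 ∧ ∀ i ∉ S, ∃ k ∈ S, Q k ≠ P i k

/-- If `Q` is `P i` outside `G ∋ i` and the functions indexed by `J` agree with `Q` on `G`, then
one point of a defeating set for `Q` is spent on `i`, so only `r` points are left for `J`. -/
lemma exists_popular_disagreement_off {r : ℕ} (hP : AllDefeated P r) {i : α} {Q : α → Fin 2}
    {G J : Finset α} (hiG : i ∈ G) (hQi : ∀ k ∉ G, Q k = P i k)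
    (hJG : ∀ j ∈ J, ∀ k ∈ G, k ≠ j ∧ Q k = P j k) {c : ℕ} (hJ : r * (c + 1) < #J) :
    ∃ k, c < #{j ∈ J | k ≠ j ∧ Q k ≠ P j k} := by
  obtain ⟨S, hS, hSQ⟩ := hP Q
  obtain ⟨x, hxS, hxG⟩ : ∃ x ∈ S, x ∈ G := by
    by_cases hiS : i ∈ S
    · exact ⟨i, hiS, hiG⟩
    · obtain ⟨k, hk, hne⟩ := hSQ i hiS
      exact ⟨k, hk, by_contra fun hkG => hne (hQi k hkG)⟩
  have hcard : #(S \ G) ≤ r := by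
    have hlt : #(S \ G) < #S :=
      card_lt_card ⟨sdiff_subset, fun h => (mem_sdiff.1 (h hxS)).2 hxG⟩
    omega
  obtain ⟨k, -, hk⟩ := exists_popular_disagreement (P := P) (Q := Q) hcard (fun b hb hbR => by
    have hbS : b ∉ S := fun hbS => hbR (mem_sdiff.2 ⟨hbS, fun hbG => (hJG b hb b hbG).1 rfl⟩)
    obtain ⟨k, hk, hne⟩ := hSQ b hbS
    exact ⟨k, mem_sdiff.2 ⟨hk, fun hkG => hne (hJG b hb k hkG).2⟩, hne⟩) hJ
  exact ⟨k, hk⟩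

/-- `Q` is `P i` modified on `G`, and the functions indexed by `J` agree with `Q` on `G` and
have at most `t` disagreements with `Q`. Then `J` is small: otherwise one popular disagreement
can be corrected, which lowers `t`. -/
lemma card_lt_of_few_disagreements [Fintype α] {r : ℕ} (hr : 2 ≤ r) (hP : AllDefeated P r)
    {i : α} (t : ℕ) (Q : α → Fin 2) (G J : Finset α) (hiG : i ∈ G)
    (hQi : ∀ k ∉ G, Q k = P i k) (hJG : ∀ j ∈ J, ∀ k ∈ G, k ≠ j ∧ Q k = P j k)
    (hdis : ∀ j ∈ J, #{k | k ≠ j ∧ Q k ≠ P j k} ≤ t) : #J + 1 < 2 * r ^ (t + 1) := by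
  induction t generalizing Q G J with
  | zero =>
    by_contra! hJ
    obtain ⟨k, hk⟩ := exists_popular_disagreement_off hP hiG hQi hJG (c := 0)
      (by simp only [zero_add, pow_one] at hJ; omega)
    obtain ⟨j, hj⟩ := card_pos.1 hk
    obtain ⟨hjJ, hkj⟩ := mem_filter.1 hj
    have hpos : 0 < #{k | k ≠ j ∧ Q k ≠ P j k} :=
      card_pos.2 ⟨k, mem_filter.2 ⟨mem_univ k, hkj⟩⟩
    have hle := hdis j hjJ
    omega
  | succ t ih =>
    by_contra! hJ
    have hrpow : 2 ≤ r ^ (t + 1) := hr.trans (Nat.le_self_pow (by omega) r)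
    obtain ⟨c, hc⟩ : ∃ c, 2 * r ^ (t + 1) = c + 2 := ⟨2 * r ^ (t + 1) - 2, by omega⟩
    have hrc : r * (c + 1) < #J := by
      have : 2 * r ^ (t + 1 + 1) = r * (c + 2) := by rw [← hc]; ring
      nlinarith
    obtain ⟨k, hk⟩ := exists_popular_disagreement_off hP hiG hQi hJG hrc
    have hlt := ih (Function.update Q k (1 - Q k)) (insert k G)
      {j ∈ J | k ≠ j ∧ Q k ≠ P j k} (mem_insert_of_mem hiG) ?_ ?_ ?_
    · omega
    · intro x hx
      rw [mem_insert, not_or] at hx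
      rw [Function.update_of_ne hx.1, hQi x hx.2]
    · intro j hj x hx
      obtain ⟨hjJ, hkj, hne⟩ := mem_filter.1 hj
      by_cases hxk : x = k
      · subst hxk
        rw [Function.update_self]
        exact ⟨hkj, by omega⟩
      · rw [Function.update_of_ne hxk]
        exact hJG j hjJ x (mem_of_mem_insert_of_ne hx hxk)
    · intro j hj
      obtain ⟨hjJ, hkj, hne⟩ := mem_filter.1 hj
      have hmem : k ∈ ({x | x ≠ j ∧ Q x ≠ P j x} : Finset α) := by simp [hkj, hne]
      have hsub : ({x | x ≠ j ∧ Function.update Q k (1 - Q k) x ≠ P j x} : Finset α) ⊆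
          ({x | x ≠ j ∧ Q x ≠ P j x} : Finset α).erase k := by
        intro x hx
        obtain ⟨-, hxj, hxne⟩ := mem_filter.1 hx
        by_cases hxk : x = k
        · subst hxk
          rw [Function.update_self] at hxne
          exact absurd (by omega) hxne
        · rw [Function.update_of_ne hxk] at hxne
          simp [hxk, hxj, hxne]
      have hle := card_le_card hsub
      rw [card_erase_of_mem hmem] at hle
      have hd := hdis j hjJ
      omega

lemma card_le_four_mul_pow [Fintype α] {r d : ℕ} (hr : 2 ≤ r) (hP : AllDefeated P r)
    (hclose : ∀ i j, #{k | k ≠ i ∧ k ≠ j ∧ P i k ≠ P j k} ≤ d) (i : α) :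
    Fintype.card α ≤ 4 * r ^ (d + 1) := by
  obtain ⟨v, hv⟩ := exists_majority_value P univ i
  have hlt := card_lt_of_few_disagreements hr hP d (Function.update (P i) i v) {i}
    {j | i ≠ j ∧ P j i = v} (mem_singleton_self i) ?_ ?_ ?_
  · rw [card_univ] at hv
    omega
  · intro k hk
    rw [Function.update_of_ne (by simpa using hk)]
  · intro j hj k hk
    obtain ⟨-, hij, hji⟩ := mem_filter.1 hj
    obtain rfl := mem_singleton.1 hk
    exact ⟨hij, by rw [Function.update_self, hji]⟩
  · intro j hj
    obtain ⟨-, hij, hji⟩ := mem_filter.1 hj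
    refine (card_le_card fun k hk => ?_).trans (hclose i j)
    obtain ⟨-, hkj, hne⟩ := mem_filter.1 hk
    by_cases hki : k = i
    · subst hki
      exact absurd (by rw [Function.update_self, hji]) hne
    · rw [Function.update_of_ne hki] at hne
      simp [hki, hkj, hne]

/-- There are families `A`, `B` of at least `a` and `b` indices and `t` points at which every
function of `A` differs from every function of `B`. -/
def Separated (P : α → α → Fin 2) (t a b : ℕ) : Prop :=
  ∃ (T A B : Finset α) (w : α → Fin 2), #T = t ∧ a ≤ #A ∧ b ≤ #B ∧
    (∀ k ∈ T, ∀ x ∈ A, k ≠ x ∧ P x k ≠ w k) ∧ ∀ k ∈ T, ∀ x ∈ B, k ≠ x ∧ P x k = w k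

/-- Follow the majority of `A` off the separating points and `B` on them: a popular disagreement
with `B` is a new separating point. -/
lemma Separated.step {r t a b : ℕ} (hr : 2 ≤ r) (hP : AllDefeated P r) (ha : 1 ≤ a)
    (h : Separated P t (2 * b) (2 * r * a)) : Separated P (t + 1) a b := by
  obtain ⟨T, A, B, w, rfl, hA, hB, hTA, hTB⟩ := h
  choose v hv using exists_majority_value P A
  set Q : α → Fin 2 := fun k => if k ∈ T then w k else v k with hQ
  obtain ⟨S, hS, hSQ⟩ := hP Q
  obtain ⟨c, rfl⟩ : ∃ c, a = c + 1 := ⟨a - 1, by omega⟩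
  obtain ⟨k, -, hk⟩ := exists_popular_disagreement (P := P) (Q := Q) (c := c) hS
    (fun x _ hxS => hSQ x hxS) (B := B) (by nlinarith)
  have hkT : k ∉ T := by
    intro hkT
    obtain ⟨x, hx⟩ := card_pos.1 (by omega : 0 < #{x ∈ B | k ≠ x ∧ Q k ≠ P x k})
    obtain ⟨hxB, -, hne⟩ := mem_filter.1 hx
    exact hne (by simp [hQ, hkT, (hTB k hkT x hxB).2])
  have hQk : Q k = v k := by simp [hQ, hkT]
  refine ⟨insert k T, {x ∈ B | k ≠ x ∧ Q k ≠ P x k}, {x ∈ A | k ≠ x ∧ P x k = v k},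
    Function.update (fun y => 1 - w y) k (v k), card_insert_of_notMem hkT, hk, ?_, ?_, ?_⟩
  · have hvk := hv k
    omega
  · intro y hy x hx
    obtain ⟨hxB, hkx, hne⟩ := mem_filter.1 hx
    by_cases hyk : y = k
    · subst hyk
      rw [Function.update_self, ← hQk]
      exact ⟨hkx, hne.symm⟩
    · rw [Function.update_of_ne hyk]
      obtain ⟨hyx, heq⟩ := hTB y (mem_of_mem_insert_of_ne hy hyk) x hxB
      exact ⟨hyx, by omega⟩
  · intro y hy x hx
    obtain ⟨hxA, hkx, heq⟩ := mem_filter.1 hx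
    by_cases hyk : y = k
    · subst hyk
      rw [Function.update_self]
      exact ⟨hkx, heq⟩
    · rw [Function.update_of_ne hyk]
      obtain ⟨hyx, hne⟩ := hTA y (mem_of_mem_insert_of_ne hy hyk) x hxA
      exact ⟨hyx, by omega⟩

lemma Separated.iterate {r : ℕ} (hr : 2 ≤ r) (hP : AllDefeated P r) (s t : ℕ)
    (h : Separated P t ((4 * r) ^ s) ((4 * r) ^ s)) : Separated P (t + 2 * s) 1 1 := by
  induction s generalizing t with
  | zero => simpa using h
  | succ s ih =>
    have hpos : 1 ≤ (4 * r) ^ s := Nat.one_le_pow _ _ (by omega)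
    have hfirst : Separated P (t + 1) (2 * (4 * r) ^ s) (2 * r * (4 * r) ^ s) := by
      refine Separated.step hr hP (by omega) ?_
      convert h using 1 <;> ring
    have hrest := ih (t + 1 + 1) (hfirst.step hr hP hpos)
    convert hrest using 1
    ring

lemma Separated.le [Fintype α] {d t : ℕ}
    (hclose : ∀ i j, #{k | k ≠ i ∧ k ≠ j ∧ P i k ≠ P j k} ≤ d) (h : Separated P t 1 1) :
    t ≤ d := by
  obtain ⟨T, A, B, w, rfl, hA, hB, hTA, hTB⟩ := h
  obtain ⟨x, hx⟩ := card_pos.1 hA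
  obtain ⟨y, hy⟩ := card_pos.1 hB
  refine (card_le_card fun k hk => ?_).trans (hclose x y)
  obtain ⟨hkx, hne⟩ := hTA k hk x hx
  obtain ⟨hky, heq⟩ := hTB k hk y hy
  simp [hkx, hky, heq, hne]

lemma card_lt_four_mul_pow [Fintype α] {r d : ℕ} (hr : 2 ≤ r) (hP : AllDefeated P r)
    (hclose : ∀ i j, #{k | k ≠ i ∧ k ≠ j ∧ P i k ≠ P j k} ≤ d) :
    Fintype.card α < (4 * r) ^ (d / 2 + 1) := by
  by_contra! hcard
  have hstart : Separated P 0 ((4 * r) ^ (d / 2 + 1)) ((4 * r) ^ (d / 2 + 1)) :=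
    ⟨∅, univ, univ, fun _ => 0, by simp, by simpa using hcard, by simpa using hcard,
      by simp, by simp⟩
  have hle := (hstart.iterate hr hP).le hclose
  omega

end CloseFunctions

/-- Lemma 13: the combinatorial lemma on close Boolean functions. -/
theorem close_functions {α : Type*} [Fintype α] [Nonempty α] (r d : ℕ) (hr : 2 ≤ r)
    (P : α → α → Fin 2)
    (hclose : ∀ i j : α, ({k : α | k ≠ i ∧ k ≠ j ∧ P i k ≠ P j k}).ncard ≤ d)
    (hcard : min (4 * (r : ℝ) ^ (d + 1)) ((4 * (r : ℝ)) ^ ((d : ℝ) / 2 + 1)) <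
      (Fintype.card α : ℝ)) :
    ∃ Q : α → Fin 2, ∀ S : Finset α, S.card ≤ r + 1 →
      ∃ i : α, i ∉ S ∧ ∀ k ∈ S, Q k = P i k := by
  classical
  by_contra hno
  have hP : CloseFunctions.AllDefeated P r := by
    intro Q
    by_contra! hQ
    exact hno ⟨Q, hQ⟩
  have hclose' : ∀ i j : α,
      (Finset.univ.filter fun k => k ≠ i ∧ k ≠ j ∧ P i k ≠ P j k).card ≤ d := by
    intro i j
    rw [← Set.ncard_coe_finset]
    simpa using hclose i j
  rcases min_lt_iff.1 hcard with h | h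
  · have hle := CloseFunctions.card_le_four_mul_pow hr hP hclose' (Classical.arbitrary α)
    have hle' : (Fintype.card α : ℝ) ≤ 4 * (r : ℝ) ^ (d + 1) := by exact_mod_cast hle
    linarith
  · have hlt := CloseFunctions.card_lt_four_mul_pow hr hP hclose'
    have hlt' : (Fintype.card α : ℝ) < (4 * (r : ℝ)) ^ (d / 2 + 1) := by exact_mod_cast hlt
    have hr' : (2 : ℝ) ≤ r := by exact_mod_cast hr
    have hpow : (4 * (r : ℝ)) ^ (d / 2 + 1) ≤ (4 * (r : ℝ)) ^ ((d : ℝ) / 2 + 1) := by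
      rw [← Real.rpow_natCast]
      refine Real.rpow_le_rpow_of_exponent_le (by linarith) ?_
      have hdiv : ((d / 2 : ℕ) : ℝ) ≤ (d : ℝ) / 2 := by exact_mod_cast Nat.cast_div_le
      push_cast
      linarith
    linarith
end

section
/- Let r, s ∈ ℕ with r ≥ s and r ≥ 2. Then every (r,s)-critical permutation has length at most min(4·r^{2rs+1}, (4r)^{rs+1}). -/
section Bipartition

variable {V : Type*} [DecidableEq V]

/-- The vertices `y` outside `C` whose bipartition `g y` agrees with `f` on `C` and differs from
`f` in at most `j` vertices of the complement of `C`, not counting `y` itself. -/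
def closeVertices [Fintype V] (g : V → V → Bool) (C : Finset V) (f : V → Bool) (j : ℕ) :
    Finset V :=
  {y | y ∉ C ∧ (∀ v ∈ C, g y v = f v) ∧
    (Finset.univ.filter fun v => v ∉ C ∧ v ≠ y ∧ g y v ≠ f v).card ≤ j}

variable {Bad : Finset V → Bool → Prop} {g : V → V → Bool} {k : ℕ}

/-- A monochromatic bad set meets the set of committed vertices. -/
theorem card_sdiff_committed_le (hcard : ∀ Y b, Bad Y b → Y.card ≤ k + 1)
    (hg : ∀ y Y b, Bad Y b → y ∉ Y → ∃ v ∈ Y, g y v ≠ b) {p : V} {C : Finset V} {f : V → Bool}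
    (hp : p ∈ C) (hf : ∀ v ∉ C, f v = g p v) {Y : Finset V} {b : Bool} (hY : Bad Y b)
    (hYb : ∀ v ∈ Y, f v = b) : (Y \ C).card ≤ k := by
  obtain ⟨c, hcY, hcC⟩ : ∃ c ∈ Y, c ∈ C := by
    by_contra! hdis
    obtain ⟨v, hv, hvb⟩ := hg p Y b hY fun h => hdis p h hp
    exact hvb ((hf v (hdis v hv)).symm.trans (hYb v hv))
  have hlt : (Y \ C).card < Y.card :=
    Finset.card_lt_card ⟨Finset.sdiff_subset, fun h => (Finset.mem_sdiff.1 (h hcY)).2 hcC⟩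
  have := hcard Y b hY
  omega

variable [Fintype V]

/-- Bounded search tree: branch on a vertex of a monochromatic bad set which changes side. -/
theorem card_closeVertices_add_two_le (hk : 2 ≤ k)
    (hnot : ∀ f : V → Bool, ∃ Y b, Bad Y b ∧ ∀ v ∈ Y, f v = b)
    (hcard : ∀ Y b, Bad Y b → Y.card ≤ k + 1)
    (hg : ∀ y Y b, Bad Y b → y ∉ Y → ∃ v ∈ Y, g y v ≠ b) (p : V) (j : ℕ) :
    ∀ (C : Finset V) (f : V → Bool), p ∈ C → (∀ v ∉ C, f v = g p v) →
      (closeVertices g C f j).card + 2 ≤ 2 * k ^ (j + 1) := by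
  induction j with
  | zero =>
    intro C f hp hf
    obtain ⟨Y, b, hY, hYb⟩ := hnot f
    have hsdiff := card_sdiff_committed_le hcard hg hp hf hY hYb
    have hsub : closeVertices g C f 0 ⊆ Y \ C := by
      intro y hy
      simp only [closeVertices, Finset.mem_filter, Finset.mem_univ, true_and] at hy
      obtain ⟨hyC, hag, hle⟩ := hy
      by_contra hyY
      have hyY' : y ∉ Y := fun h => hyY (Finset.mem_sdiff.2 ⟨h, hyC⟩)
      obtain ⟨v, hv, hvb⟩ := hg y Y b hY hyY'
      have hne : g y v ≠ f v := by rwa [hYb v hv]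
      have hmem : v ∈ Finset.univ.filter fun v => v ∉ C ∧ v ≠ y ∧ g y v ≠ f v := by
        simp only [Finset.mem_filter, Finset.mem_univ, true_and]
        exact ⟨fun h => hne (hag v h), fun h => hyY' (h ▸ hv), hne⟩
      have := Finset.card_pos.2 ⟨v, hmem⟩
      omega
    have := Finset.card_le_card hsub
    simp only [zero_add, pow_one]
    omega
  | succ j ih =>
    intro C f hp hf
    obtain ⟨Y, b, hY, hYb⟩ := hnot f
    have hsdiff := card_sdiff_committed_le hcard hg hp hf hY hYb
    have hsub : closeVertices g C f (j + 1) ⊆ (Y \ C) ∪ (Y \ C).biUnion fun v =>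
        closeVertices g (insert v C) (Function.update f v (!f v)) j := by
      intro y hy
      simp only [closeVertices, Finset.mem_filter, Finset.mem_univ, true_and] at hy
      obtain ⟨hyC, hag, hle⟩ := hy
      by_cases hyY : y ∈ Y
      · exact Finset.mem_union_left _ (Finset.mem_sdiff.2 ⟨hyY, hyC⟩)
      obtain ⟨v, hv, hvb⟩ := hg y Y b hY hyY
      have hne : g y v ≠ f v := by rwa [hYb v hv]
      have hvC : v ∉ C := fun h => hne (hag v h)
      have hvy : v ≠ y := fun h => hyY (h ▸ hv)
      refine Finset.mem_union_right _ (Finset.mem_biUnion.2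
        ⟨v, Finset.mem_sdiff.2 ⟨hv, hvC⟩, ?_⟩)
      simp only [closeVertices, Finset.mem_filter, Finset.mem_univ, true_and]
      refine ⟨?_, ?_, ?_⟩
      · simp [hvy.symm, hyC]
      · intro w hw
        by_cases hwv : w = v
        · subst hwv
          simpa [Bool.eq_not] using hne
        · rw [Function.update_of_ne hwv]
          exact hag w ((Finset.mem_insert.1 hw).resolve_left hwv)
      · have hlt := Finset.card_lt_card (s := Finset.univ.filter fun w =>
            w ∉ insert v C ∧ w ≠ y ∧ g y w ≠ Function.update f v (!f v) w)
          (t := Finset.univ.filter fun w => w ∉ C ∧ w ≠ y ∧ g y w ≠ f w) ?_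
        · omega
        · rw [Finset.ssubset_iff_of_subset]
          · exact ⟨v, by simp [hvC, hvy, hne], by simp⟩
          · intro w hw
            simp only [Finset.mem_filter, Finset.mem_univ, true_and, Finset.mem_insert,
              not_or] at hw ⊢
            obtain ⟨⟨hwv, hwC⟩, hwy, hwf⟩ := hw
            rw [Function.update_of_ne hwv] at hwf
            exact ⟨hwC, hwy, hwf⟩
    have hchild : ∀ v ∈ Y \ C, (closeVertices g (insert v C)
        (Function.update f v (!f v)) j).card ≤ 2 * k ^ (j + 1) - 2 := by
      intro v _
      have := ih (insert v C) (Function.update f v (!f v)) (Finset.mem_insert_of_mem hp) ?_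
      · omega
      · intro w hw
        rw [Finset.mem_insert, not_or] at hw
        rw [Function.update_of_ne hw.1, hf w hw.2]
    have hunion := (Finset.card_le_card hsub).trans (Finset.card_union_le _ _)
    have hbi := Finset.card_biUnion_le_card_mul _ _ _ hchild
    have hmul := Nat.mul_le_mul_right (2 * k ^ (j + 1) - 2) hsdiff
    have hpos : 1 ≤ k ^ (j + 1) := Nat.one_le_pow _ _ (by omega)
    obtain ⟨a, ha⟩ : ∃ a, k ^ (j + 1) = a + 1 := ⟨k ^ (j + 1) - 1, by omega⟩
    have hsimp : 2 * k ^ (j + 1) - 2 = 2 * a := by omega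
    rw [hsimp] at hbi hmul
    rw [pow_succ k (j + 1), ha]
    nlinarith

/-- Guess the sides of the vertices of `D`, then search to depth `e` outside of `D`. -/
theorem card_le_of_forall_close (hk : 2 ≤ k)
    (hnot : ∀ f : V → Bool, ∃ Y b, Bad Y b ∧ ∀ v ∈ Y, f v = b)
    (hcard : ∀ Y b, Bad Y b → Y.card ≤ k + 1)
    (hg : ∀ y Y b, Bad Y b → y ∉ Y → ∃ v ∈ Y, g y v ≠ b) {p : V} {D : Finset V} {e : ℕ}
    (hp : p ∈ D)
    (hclose : ∀ y ∉ D,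
      (Finset.univ.filter fun v => v ∉ D ∧ v ≠ y ∧ g y v ≠ g p v).card ≤ e) :
    Fintype.card V ≤ D.card + 2 ^ D.card * (2 * k ^ (e + 1) - 2) := by
  let f : Finset V → V → Bool := fun A v => if v ∈ D then decide (v ∈ A) else g p v
  have hsub : (Finset.univ : Finset V) ⊆
      D ∪ D.powerset.biUnion fun A => closeVertices g D (f A) e := by
    intro y _
    by_cases hyD : y ∈ D
    · exact Finset.mem_union_left _ hyD
    refine Finset.mem_union_right _ (Finset.mem_biUnion.2
      ⟨D.filter fun v => g y v = true, by simp, ?_⟩)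
    simp only [closeVertices, Finset.mem_filter, Finset.mem_univ, true_and]
    refine ⟨hyD, fun v hv => by simp [f, hv], (Finset.card_le_card ?_).trans (hclose y hyD)⟩
    intro v hv
    simp only [Finset.mem_filter, Finset.mem_univ, true_and] at hv ⊢
    refine ⟨hv.1, hv.2.1, ?_⟩
    simpa [f, hv.1] using hv.2.2
  have hunion := (Finset.card_le_card hsub).trans (Finset.card_union_le _ _)
  have hbi := Finset.card_biUnion_le_card_mul D.powerset
    (fun A => closeVertices g D (f A) e) (2 * k ^ (e + 1) - 2) fun A _ => by
      have := card_closeVertices_add_two_le hk hnot hcard hg p e D (f A) hp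
        fun v hv => by simp [f, hv]
      omega
  rw [Finset.card_powerset] at hbi
  rw [Finset.card_univ] at hunion
  omega

/-- The vertices other than `x` and `y` on which the bipartitions `g x` and `g y` differ. -/
def disagreement (g : V → V → Bool) (x y : V) : Finset V :=
  {v | v ≠ x ∧ v ≠ y ∧ g x v ≠ g y v}

theorem card_disagreement_le {t : ℕ}
    (ht : ∀ x y, (Finset.univ.filter fun v =>
      v ≠ x ∧ v ≠ y ∧ g x v = true ∧ g y v = false).card ≤ t) (x y : V) :
    (disagreement g x y).card ≤ 2 * t := by
  have hsub : disagreement g x y ⊆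
      (Finset.univ.filter fun v => v ≠ x ∧ v ≠ y ∧ g x v = true ∧ g y v = false) ∪
      (Finset.univ.filter fun v => v ≠ y ∧ v ≠ x ∧ g y v = true ∧ g x v = false) := by
    intro v hv
    simp only [disagreement, Finset.mem_filter, Finset.mem_univ, true_and,
      Finset.mem_union] at hv ⊢
    cases hx : g x v <;> cases hy : g y v <;> simp_all
  have := (Finset.card_le_card hsub).trans (Finset.card_union_le _ _)
  have := ht x y
  have := ht y x
  omega

theorem card_le_four_mul_pow (hk : 2 ≤ k)
    (hnot : ∀ f : V → Bool, ∃ Y b, Bad Y b ∧ ∀ v ∈ Y, f v = b)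
    (hcard : ∀ Y b, Bad Y b → Y.card ≤ k + 1)
    (hg : ∀ y Y b, Bad Y b → y ∉ Y → ∃ v ∈ Y, g y v ≠ b) {d : ℕ}
    (hd : ∀ x y, (disagreement g x y).card ≤ d) :
    Fintype.card V ≤ 4 * k ^ (d + 1) := by
  rcases isEmpty_or_nonempty V with hV | ⟨⟨p⟩⟩
  · simp
  have hbound := card_le_of_forall_close (e := d) hk hnot hcard hg (Finset.mem_singleton_self p)
    fun y hy => (Finset.card_le_card fun v hv => ?_).trans (hd y p)
  · rw [Finset.card_singleton, pow_one] at hbound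
    have : 1 ≤ k ^ (d + 1) := Nat.one_le_pow _ _ (by omega)
    omega
  · simp only [disagreement, Finset.mem_filter, Finset.mem_univ, true_and,
      Finset.mem_singleton] at hv ⊢
    exact ⟨hv.2.1, hv.1, hv.2.2⟩

/-- If `g p` and `g q` are farthest apart, then outside of their disagreement every other `g y`
is at most half as far from `g p`. -/
theorem card_le_four_mul_self_pow (hk : 2 ≤ k)
    (hnot : ∀ f : V → Bool, ∃ Y b, Bad Y b ∧ ∀ v ∈ Y, f v = b)
    (hcard : ∀ Y b, Bad Y b → Y.card ≤ k + 1)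
    (hg : ∀ y Y b, Bad Y b → y ∉ Y → ∃ v ∈ Y, g y v ≠ b) {t : ℕ}
    (hd : ∀ x y, (disagreement g x y).card ≤ 2 * t) :
    Fintype.card V ≤ (4 * k) ^ (t + 1) := by
  rcases isEmpty_or_nonempty V with hV | hV
  · simp
  obtain ⟨⟨p, q⟩, hmax⟩ :=
    Finite.exists_max fun x : V × V => (disagreement g x.1 x.2).card
  set D := disagreement g p q with hD
  have hDt : D.card ≤ 2 * t := hd p q
  have hclose : ∀ y ∉ insert p D,
      (Finset.univ.filter fun v => v ∉ insert p D ∧ v ≠ y ∧ g y v ≠ g p v).card ≤ t := by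
    intro y hy
    rw [Finset.mem_insert, not_or] at hy
    set E := Finset.univ.filter fun v => v ∉ insert p D ∧ v ≠ y ∧ g y v ≠ g p v with hE
    have hEp : E ∪ D.filter (fun v => g y v ≠ g p v) ⊆ disagreement g y p := by
      intro v hv
      simp only [hE, hD, disagreement, Finset.mem_union, Finset.mem_filter, Finset.mem_univ,
        true_and, Finset.mem_insert, not_or] at hv hy ⊢
      grind
    have hEq : E.erase q ∪ D.filter (fun v => g y v = g p v) ⊆ disagreement g y q := by
      intro v hv
      simp only [hE, hD, disagreement, Finset.mem_union, Finset.mem_filter, Finset.mem_univ,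
        true_and, Finset.mem_insert, not_or, Finset.mem_erase] at hv hy ⊢
      grind
    have hED : Disjoint E D := by
      rw [Finset.disjoint_left]
      intro v hv hvD
      simp only [hE, Finset.mem_filter] at hv
      exact hv.2.1 (Finset.mem_insert_of_mem hvD)
    have hcardp := Finset.card_le_card hEp
    have hcardq := Finset.card_le_card hEq
    rw [Finset.card_union_of_disjoint (hED.mono_right (Finset.filter_subset _ _))] at hcardp
    rw [Finset.card_union_of_disjoint ((hED.mono_left (Finset.erase_subset _ _)).mono_right
      (Finset.filter_subset _ _))] at hcardq
    have hsplit := Finset.card_filter_add_card_filter_not (s := D) (fun v => g y v = g p v)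
    have herase := Finset.pred_card_le_card_erase (s := E) (a := q)
    have hmaxp : (disagreement g y p).card ≤ D.card := hmax (y, p)
    have hmaxq : (disagreement g y q).card ≤ D.card := hmax (y, q)
    simp only [ne_eq] at hcardp
    omega
  have hbound := card_le_of_forall_close hk hnot hcard hg (Finset.mem_insert_self p D) hclose
  have hins : (insert p D).card ≤ 2 * t + 1 := (Finset.card_insert_le p D).trans (by omega)
  have hpow : 2 ^ (insert p D).card ≤ 2 * 4 ^ t := by
    calc 2 ^ (insert p D).card ≤ 2 ^ (2 * t + 1) := Nat.pow_le_pow_right (by omega) hins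
      _ = 2 * 4 ^ t := by rw [pow_succ, pow_mul]; norm_num [mul_comm]
  have hmul := Nat.mul_le_mul_right (2 * k ^ (t + 1) - 2) hpow
  have hlin : t < 4 ^ t := Nat.lt_pow_self (by omega)
  have hpos : 1 ≤ k ^ (t + 1) := Nat.one_le_pow _ _ (by omega)
  obtain ⟨a, ha⟩ : ∃ a, k ^ (t + 1) = a + 1 := ⟨k ^ (t + 1) - 1, by omega⟩
  have hsimp : 2 * k ^ (t + 1) - 2 = 2 * a := by omega
  rw [hsimp] at hbound hmul
  rw [mul_pow, ha, pow_succ]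
  nlinarith

end Bipartition

section Chains

/-- A set without `m + 1` pairwise `rel`-related elements is `m`-colorable with no two
`rel`-related elements of the same color. -/
theorem exists_coloring_of_chain_card_le {n m : ℕ} (rel : Fin n → Fin n → Prop)
    (htrans : ∀ i j l, rel i j → rel j l → rel i l) (S : Set (Fin n))
    (hS : ∀ Y : Finset (Fin n), (∀ i ∈ Y, i ∈ S) →
      (∀ i ∈ Y, ∀ j ∈ Y, i < j → rel i j) → Y.card ≤ m) :
    ∃ c : S → Fin m, ∀ i j : S, i < j → rel i j → c i ≠ c j := by
  classical
  let chains : Fin n → Finset (Finset (Fin n)) := fun x => Finset.univ.filter fun Y =>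
    (∀ i ∈ Y, i ∈ S) ∧ (∀ i ∈ Y, ∀ j ∈ Y, i < j → rel i j) ∧ x ∈ Y ∧ ∀ i ∈ Y, i ≤ x
  let height : Fin n → ℕ := fun x => (chains x).sup Finset.card
  have hsingle : ∀ x ∈ S, {x} ∈ chains x := by
    intro x hx
    simp [chains, hx]
  have hpos : ∀ x ∈ S, 1 ≤ height x := fun x hx =>
    Finset.le_sup (f := Finset.card) (hsingle x hx)
  have hle : ∀ x, height x ≤ m := fun x => Finset.sup_le fun Y hY => by
    simp only [chains, Finset.mem_filter, Finset.mem_univ, true_and] at hY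
    exact hS Y hY.1 hY.2.1
  have hlt : ∀ x ∈ S, ∀ y ∈ S, x < y → rel x y → height x < height y := by
    intro x hx y hy hxy hrel
    obtain ⟨Y, hY, hYcard⟩ := Finset.exists_mem_eq_sup (chains x) ⟨_, hsingle x hx⟩ Finset.card
    simp only [chains, Finset.mem_filter, Finset.mem_univ, true_and] at hY
    obtain ⟨hYS, hYrel, hxY, hYx⟩ := hY
    have hYy : ∀ i ∈ Y, i < y := fun i hi => (hYx i hi).trans_lt hxy
    have hrely : ∀ i ∈ Y, rel i y := fun i hi => by
      rcases (hYx i hi).lt_or_eq with h | h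
      · exact htrans _ _ _ (hYrel i hi x hxY h) hrel
      · exact h ▸ hrel
    have hmem : insert y Y ∈ chains y := by
      simp only [chains, Finset.mem_filter, Finset.mem_univ, true_and, Finset.mem_insert]
      refine ⟨?_, ?_, by simp, ?_⟩
      · rintro i (rfl | hi)
        exacts [hy, hYS i hi]
      · rintro i (rfl | hi) j (rfl | hj) hij
        · exact absurd hij (lt_irrefl _)
        · exact absurd hij (hYy j hj).not_gt
        · exact hrely i hi
        · exact hYrel i hi j hj hij
      · rintro i (rfl | hi)
        exacts [le_rfl, (hYy i hi).le]
    have hsup := Finset.le_sup (f := Finset.card) hmem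
    rw [Finset.card_insert_of_notMem fun h => (hYy y h).false] at hsup
    change (chains x).sup Finset.card < (chains y).sup Finset.card
    omega
  refine ⟨fun x => ⟨height x - 1, ?_⟩, fun i j hij hrel h => ?_⟩
  · have := hpos x x.2
    have := hle x
    omega
  · have := hlt i i.2 j j.2 hij hrel
    have := hpos i i.2
    simp only [Fin.mk.injEq] at h
    omega

/-- `Y` is an obstruction for the side `b`: a decreasing subsequence of length `r + 1` if `b` is
`true`, and an increasing subsequence of length `s + 1` if `b` is `false`. -/
def IsObstruction {n : ℕ} (π : Equiv.Perm (Fin n)) (r s : ℕ) (Y : Finset (Fin n))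
    (b : Bool) : Prop :=
  if b then Y.card = r + 1 ∧ IsDecOn π Y else Y.card = s + 1 ∧ IsIncOn π Y

theorem exists_isObstruction_of_not_coverable {n r s : ℕ} {π : Equiv.Perm (Fin n)}
    (h : ¬ Coverable π r s) (f : Fin n → Bool) :
    ∃ Y b, IsObstruction π r s Y b ∧ ∀ v ∈ Y, f v = b := by
  classical
  by_contra! hno
  have hdec : ∀ Y : Finset (Fin n), (∀ i ∈ Y, i ∈ {v | f v = true}) →
      (∀ i ∈ Y, ∀ j ∈ Y, i < j → π j < π i) → Y.card ≤ r := by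
    intro Y hY hYrel
    by_contra! hcard
    obtain ⟨Z, hZY, hZ⟩ := Finset.exists_subset_card_eq hcard
    obtain ⟨v, hv, hvb⟩ := hno Z true
      (by simpa [IsObstruction] using
        ⟨hZ, fun i hi j hj => hYrel i (hZY hi) j (hZY hj)⟩)
    exact hvb (hY v (hZY hv))
  have hinc : ∀ Y : Finset (Fin n), (∀ i ∈ Y, i ∈ {v | f v = false}) →
      (∀ i ∈ Y, ∀ j ∈ Y, i < j → π i < π j) → Y.card ≤ s := by
    intro Y hY hYrel
    by_contra! hcard
    obtain ⟨Z, hZY, hZ⟩ := Finset.exists_subset_card_eq hcard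
    obtain ⟨v, hv, hvb⟩ := hno Z false
      (by simpa [IsObstruction] using
        ⟨hZ, fun i hi j hj => hYrel i (hZY hi) j (hZY hj)⟩)
    exact hvb (hY v (hZY hv))
  obtain ⟨c, hc⟩ := exists_coloring_of_chain_card_le (fun i j => π j < π i)
    (fun _ _ _ h₁ h₂ => h₂.trans h₁) _ hdec
  obtain ⟨d, hd⟩ := exists_coloring_of_chain_card_le (fun i j => π i < π j)
    (fun _ _ _ h₁ h₂ => h₁.trans h₂) _ hinc
  refine h ⟨fun v => if hv : f v = true then Sum.inl (c ⟨v, hv⟩)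
    else Sum.inr (d ⟨v, by simpa using hv⟩), ?_, ?_⟩
  · intro a i hi j hj hij
    simp only [Set.mem_ofPred_eq] at hi hj
    split_ifs at hi hj with hfi hfj
    rw [Sum.inl.injEq] at hi hj
    by_contra hlt
    refine hc ⟨i, hfi⟩ ⟨j, hfj⟩ hij (lt_of_le_of_ne (not_lt.1 hlt) ?_) (hi.trans hj.symm)
    exact fun h => hij.ne' (π.injective h)
  · intro a i hi j hj hij
    simp only [Set.mem_ofPred_eq] at hi hj
    split_ifs at hi hj with hfi hfj
    rw [Sum.inr.injEq] at hi hj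
    by_contra hlt
    refine hd ⟨i, by simpa using hfi⟩ ⟨j, by simpa using hfj⟩ hij
      (lt_of_le_of_ne (not_lt.1 hlt) ?_) (hi.trans hj.symm)
    exact fun h => hij.ne (π.injective h)

/-- Deleting an entry from a critical permutation leaves a coverable one. -/
theorem RSCritical.exists_cover_compl_singleton {n r s : ℕ} {π : Equiv.Perm (Fin n)}
    (h : RSCritical π r s) (y : Fin n) :
    ∃ c : {v // v ≠ y} → Fin r ⊕ Fin s, ∀ i j : {v // v ≠ y}, i < j → c i = c j →
      if (c i).isLeft then π i < π j else π j < π i := by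
  obtain ⟨m, rfl⟩ : ∃ m, n = m + 1 := ⟨n - 1, by have := y.pos; omega⟩
  let τ : Equiv.Perm (Fin m) := (finSuccAboveEquiv y).trans
    ((π.subtypeEquiv fun v => by simp).trans (finSuccAboveEquiv (π y)).symm)
  have hτ : ∀ i, (π y).succAbove (τ i) = π (y.succAbove i) := by
    intro i
    have := congrArg Subtype.val ((finSuccAboveEquiv (π y)).apply_symm_apply
      ((π.subtypeEquiv (p := fun v => v ≠ y) (q := fun v => v ≠ π y) fun v => by simp)
        (finSuccAboveEquiv y i)))
    exact this
  obtain ⟨c, hcinc, hcdec⟩ := h.2 m τ ⟨m.lt_succ_self, y.succAbove,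
    Fin.strictMono_succAbove y, fun i j => by
      rw [← hτ, ← hτ, (Fin.strictMono_succAbove (π y)).lt_iff_lt]⟩
  refine ⟨fun v => c ((finSuccAboveEquiv y).symm v), fun i j hij hcij => ?_⟩
  obtain ⟨i, rfl⟩ := (finSuccAboveEquiv y).surjective i
  obtain ⟨j, rfl⟩ := (finSuccAboveEquiv y).surjective j
  replace hij : i < j := (Fin.strictMono_succAbove y).lt_iff_lt.1 hij
  simp only [Equiv.symm_apply_apply] at hcij ⊢
  simp only [finSuccAboveEquiv_apply, ← hτ, (Fin.strictMono_succAbove (π y)).lt_iff_lt]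
  cases hc : c i with
  | inl a => simpa using hcinc a i hc j (hcij.symm.trans hc) hij
  | inr b => simpa using hcdec b i hc j (hcij.symm.trans hc) hij

end Chains

/-- Corollary 14: for `r ≥ s`, `r ≥ 2`, every `(r,s)`-critical permutation has length
at most `min(4·r^(2rs+1), (4r)^(rs+1))`. -/
theorem critical_length_bound {n : ℕ} (r s : ℕ) (hrs : s ≤ r) (hr : 2 ≤ r)
    (π : Equiv.Perm (Fin n)) (h : RSCritical π r s) :
    n ≤ min (4 * r ^ (2 * r * s + 1)) ((4 * r) ^ (r * s + 1)) := by
  choose c hc using h.exists_cover_compl_singleton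
  let g : Fin n → Fin n → Bool := fun y v => if hv : v ≠ y then (c y ⟨v, hv⟩).isLeft else true
  have hcard : ∀ Y b, IsObstruction π r s Y b → Y.card ≤ r + 1 := by
    intro Y b hY
    cases b
    · simp only [IsObstruction, Bool.false_eq_true, if_false] at hY
      omega
    · simp only [IsObstruction, if_true] at hY
      omega
  have hg : ∀ y Y b, IsObstruction π r s Y b → y ∉ Y → ∃ v ∈ Y, g y v ≠ b := by
    intro y Y b hY hyY
    by_contra! hall
    have hne : ∀ v ∈ Y, v ≠ y := fun v hv hvy => hyY (hvy ▸ hv)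
    have hside : ∀ v (hv : v ∈ Y), (c y ⟨v, hne v hv⟩).isLeft = b := by
      intro v hv
      simpa [g, hne v hv] using hall v hv
    have hinj : Function.Injective fun v : Y => c y ⟨v, hne v v.2⟩ := by
      have hlt : ∀ v w : Y, v < w → c y ⟨v, hne v v.2⟩ ≠ c y ⟨w, hne w w.2⟩ := by
        intro v w hvw heq
        have hmono := hc y ⟨v, hne v v.2⟩ ⟨w, hne w w.2⟩ hvw heq
        rw [hside v v.2] at hmono
        cases b
        · simp only [IsObstruction, Bool.false_eq_true, if_false] at hY hmono
          exact lt_asymm hmono (hY.2 v v.2 w w.2 hvw)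
        · simp only [IsObstruction, if_true] at hY hmono
          exact lt_asymm hmono (hY.2 v v.2 w w.2 hvw)
      intro v w heq
      rcases lt_trichotomy v w with hvw | hvw | hvw
      exacts [absurd heq (hlt v w hvw), hvw, absurd heq.symm (hlt w v hvw)]
    cases b
    · have hright : ∀ v : Y, ∃ a, c y ⟨v, hne v v.2⟩ = Sum.inr a := fun v => by
        have := hside v v.2
        cases hcv : c y ⟨v, hne v v.2⟩ <;> simp_all
      choose a ha using hright
      have hinja : Function.Injective a := fun v w hvw => hinj (by simp only [ha, hvw])
      have := Fintype.card_le_of_injective a hinja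
      simp only [IsObstruction, Bool.false_eq_true, if_false] at hY
      rw [Fintype.card_coe, Fintype.card_fin] at this
      omega
    · have hleft : ∀ v : Y, ∃ a, c y ⟨v, hne v v.2⟩ = Sum.inl a := fun v => by
        have := hside v v.2
        cases hcv : c y ⟨v, hne v v.2⟩ <;> simp_all
      choose a ha using hleft
      have hinja : Function.Injective a := fun v w hvw => hinj (by simp only [ha, hvw])
      have := Fintype.card_le_of_injective a hinja
      simp only [IsObstruction, if_true] at hY
      rw [Fintype.card_coe, Fintype.card_fin] at this
      omega
  have ht : ∀ x y, (Finset.univ.filter fun v =>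
      v ≠ x ∧ v ≠ y ∧ g x v = true ∧ g y v = false).card ≤ r * s := by
    intro x y
    set S := Finset.univ.filter fun v => v ≠ x ∧ v ≠ y ∧ g x v = true ∧ g y v = false
    have hx : ∀ v : S, v.1 ≠ x := fun v => (Finset.mem_filter.1 v.2).2.1
    have hy : ∀ v : S, v.1 ≠ y := fun v => (Finset.mem_filter.1 v.2).2.2.1
    have hleft : ∀ v : S, ∃ a, c x ⟨v, hx v⟩ = Sum.inl a := fun v => by
      have hv := (Finset.mem_filter.1 v.2).2.2.2.1
      cases hcv : c x ⟨v, hx v⟩ <;> simp_all [g]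
    have hright : ∀ v : S, ∃ a, c y ⟨v, hy v⟩ = Sum.inr a := fun v => by
      have hv := (Finset.mem_filter.1 v.2).2.2.2.2
      cases hcv : c y ⟨v, hy v⟩ <;> simp_all [g]
    choose a ha using hleft
    choose b hb using hright
    have hlt : ∀ v w : S, v < w → (a v, b v) ≠ (a w, b w) := by
      intro v w hvw heq
      rw [Prod.mk.injEq] at heq
      have hinc := hc x ⟨v, hx v⟩ ⟨w, hx w⟩ hvw (by rw [ha, ha, heq.1])
      have hdec := hc y ⟨v, hy v⟩ ⟨w, hy w⟩ hvw (by rw [hb, hb, heq.2])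
      rw [ha] at hinc
      rw [hb] at hdec
      simp only [Sum.isLeft_inl, Sum.isLeft_inr, if_true, Bool.false_eq_true, if_false]
        at hinc hdec
      exact lt_asymm hinc hdec
    have hinj : Function.Injective fun v : S => (a v, b v) := by
      intro v w heq
      rcases lt_trichotomy v w with hvw | hvw | hvw
      exacts [absurd heq (hlt v w hvw), hvw, absurd heq.symm (hlt w v hvw)]
    simpa using Fintype.card_le_of_injective _ hinj
  have hd := card_disagreement_le ht
  have hnot := exists_isObstruction_of_not_coverable h.1
  have hfst := card_le_four_mul_pow hr hnot hcard hg hd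
  have hsnd := card_le_four_mul_self_pow hr hnot hcard hg hd
  rw [Fintype.card_fin] at hfst hsnd
  rw [← mul_assoc] at hfst
  exact le_min hfst hsnd
end

section
/- For every integer k ≥ 3, every k-critical permutation has length at most (4k)^{k²/4 + 2} (real exponentiation). -/
open Real in
lemma hasDerivAt_entropyGap {c x : ℝ} (h0 : x ≠ 0) (h1 : x ≠ 1) :
    HasDerivAt (fun x : ℝ => c * (x * (1 - x)) - binEntropy x)
      (c * (1 - 2 * x) - (log (1 - x) - log x)) x := by
  have h2 : HasDerivAt (fun x : ℝ => x * (1 - x)) (1 * (1 - x) + x * (-1)) x :=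
    (hasDerivAt_id' x).mul ((hasDerivAt_id' x).const_sub 1)
  refine ((h2.const_mul c).sub (hasDerivAt_binEntropy h0 h1)).congr_deriv ?_
  ring

open Real in
lemma hasDerivAt_deriv_entropyGap {c x : ℝ} (h0 : x ≠ 0) (h1 : x ≠ 1) :
    HasDerivAt (fun x : ℝ => c * (1 - 2 * x) - (log (1 - x) - log x))
      (1 / (x * (1 - x)) - 2 * c) x := by
  have h1' : 1 - x ≠ 0 := sub_ne_zero.2 h1.symm
  have h2 : HasDerivAt (fun x : ℝ => c * (1 - 2 * x)) (c * (-(2 * 1))) x :=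
    (((hasDerivAt_id' x).const_mul 2).const_sub 1).const_mul c
  have h3 : HasDerivAt (fun x : ℝ => log (1 - x)) (-1 / (1 - x)) x :=
    ((hasDerivAt_id' x).const_sub 1).log h1'
  refine (h2.sub (h3.sub (hasDerivAt_log h0))).congr_deriv ?_
  field_simp
  ring

open Real in
/-- Once `c * (x * (1 - x))` dominates the binary entropy at `ε ≤ 1/2`, it dominates it on the
whole interval `[ε, 1/2]`. -/
lemma binEntropy_le_mul_of_le_half {ε p c : ℝ} (hε : 0 < ε) (hc : 0 < c)
    (h : binEntropy ε ≤ c * (ε * (1 - ε))) (hp : ε ≤ p) (hp' : p ≤ 1 / 2) :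
    binEntropy p ≤ c * (p * (1 - p)) := by
  have hcont : Continuous (fun x : ℝ => c * (x * (1 - x)) - binEntropy x) := by fun_prop
  have hconvex : ∀ a : ℝ, ε ≤ a → a ≤ 1 / 2 → 2 * c * (a * (1 - a)) ≤ 1 →
      0 ≤ c * (a * (1 - a)) - binEntropy a := by
    intro a ha ha' hca
    have hconv : ConvexOn ℝ (Set.Icc 0 a) (fun x : ℝ => c * (x * (1 - x)) - binEntropy x) := by
      refine convexOn_of_hasDerivWithinAt2_nonneg (convex_Icc 0 a) hcont.continuousOn
        (f' := fun x => c * (1 - 2 * x) - (log (1 - x) - log x))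
        (f'' := fun x => 1 / (x * (1 - x)) - 2 * c) ?_ ?_ ?_ <;>
      · rw [interior_Icc]
        rintro x ⟨hx0, hx1⟩
        first
        | exact (hasDerivAt_entropyGap hx0.ne' (by linarith)).hasDerivWithinAt
        | exact (hasDerivAt_deriv_entropyGap hx0.ne' (by linarith)).hasDerivWithinAt
        | have hpos : 0 < x * (1 - x) := mul_pos hx0 (by linarith)
          have hle : x * (1 - x) ≤ a * (1 - a) := by nlinarith
          rw [sub_nonneg, le_div_iff₀ hpos]
          exact (mul_le_mul_of_nonneg_left hle (by positivity)).trans hca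
    have ha0 : 0 < a := hε.trans_le ha
    have key := hconv.2 (Set.left_mem_Icc.2 ha0.le) (Set.right_mem_Icc.2 ha0.le)
      (sub_nonneg.2 ((div_le_one ha0).2 ha)) (div_pos hε ha0).le (sub_add_cancel 1 (ε / a))
    have hε' : ε / a * a = ε := by field_simp
    simp only [smul_eq_mul, mul_zero, zero_add, binEntropy_zero, zero_mul, sub_zero, hε'] at key
    have h0 : 0 ≤ ε / a * (c * (a * (1 - a)) - binEntropy a) := by linarith
    exact nonneg_of_mul_nonneg_right h0 (by positivity)
  have hconcave : ∀ a : ℝ, 0 < a → a ≤ p → 1 ≤ 2 * c * (a * (1 - a)) →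
      0 ≤ c * (a * (1 - a)) - binEntropy a → 0 ≤ c * (p * (1 - p)) - binEntropy p := by
    intro a ha ha' hca hga
    have hconc : ConcaveOn ℝ (Set.Icc a (1 - a))
        (fun x : ℝ => c * (x * (1 - x)) - binEntropy x) := by
      refine concaveOn_of_hasDerivWithinAt2_nonpos (convex_Icc a (1 - a)) hcont.continuousOn
        (f' := fun x => c * (1 - 2 * x) - (log (1 - x) - log x))
        (f'' := fun x => 1 / (x * (1 - x)) - 2 * c) ?_ ?_ ?_ <;>
      · rw [interior_Icc]
        rintro x ⟨hx0, hx1⟩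
        first
        | exact (hasDerivAt_entropyGap (by linarith) (by linarith)).hasDerivWithinAt
        | exact (hasDerivAt_deriv_entropyGap (by linarith) (by linarith)).hasDerivWithinAt
        | have hpos : 0 < x * (1 - x) := mul_pos (by linarith) (by linarith)
          have hle : a * (1 - a) ≤ x * (1 - x) := by nlinarith
          rw [sub_nonpos, div_le_iff₀ hpos]
          exact hca.trans (mul_le_mul_of_nonneg_left hle (by positivity))
    have key := hconc.min_le_of_mem_Icc (x := a) (y := 1 - a) (z := p)
      (Set.left_mem_Icc.2 (by linarith)) (Set.right_mem_Icc.2 (by linarith))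
      ⟨ha', by linarith⟩
    refine le_trans ?_ key
    rw [binEntropy_one_sub]
    exact le_min hga (by linarith)
  rw [← sub_nonneg]
  rcases le_total (2 * c * (p * (1 - p))) 1 with h1 | h1
  · exact hconvex p hp hp' h1
  rcases le_total (2 * c * (ε * (1 - ε))) 1 with h2 | h2
  · obtain ⟨a, ⟨ha, ha'⟩, hca⟩ := intermediate_value_Icc hp
      (f := fun x : ℝ => 2 * c * (x * (1 - x))) (by fun_prop) ⟨h2, h1⟩
    exact hconcave a (hε.trans_le ha) ha' hca.ge (hconvex a ha (ha'.trans hp') hca.le)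
  · exact hconcave ε hε hp h2 (sub_nonneg.2 h)

open Real in
lemma binEntropy_le_mul {ε p c : ℝ} (hε : 0 < ε) (hc : 0 < c)
    (h : binEntropy ε ≤ c * (ε * (1 - ε))) (hp : ε ≤ p) (hp' : ε ≤ 1 - p) :
    binEntropy p ≤ c * (p * (1 - p)) := by
  rcases le_total p (1 / 2) with h2 | h2
  · exact binEntropy_le_mul_of_le_half hε hc h hp h2
  · have := binEntropy_le_mul_of_le_half hε hc h hp' (by linarith)
    rw [binEntropy_one_sub] at this
    linarith

open Real in
/-- Splitting a set of `a + b` elements into parts of sizes `a` and `b`, each containing at least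
a fraction `1 / q` of the elements, costs at most `c * (a * b / (a + b))`. -/
lemma split_log_le {a b q c : ℝ} (ha : 0 < a) (hb : 0 < b) (hq : 0 < q) (hc : 0 < c)
    (h : binEntropy (1 / q) ≤ c * (1 / q * (1 - 1 / q)))
    (haq : a + b ≤ q * a) (hbq : a + b ≤ q * b) :
    (a + b) * log (a + b) ≤ a * log a + b * log b + c * (a * b / (a + b)) := by
  have hab : 0 < a + b := by positivity
  have h1 : 1 - a / (a + b) = b / (a + b) := by field_simp; ring
  have key := binEntropy_le_mul (p := a / (a + b)) (by positivity) hc h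
    (by rw [div_le_div_iff₀ hq hab]; linarith)
    (by rw [h1, div_le_div_iff₀ hq hab]; linarith)
  rw [binEntropy, h1, inv_div, inv_div, log_div hab.ne' ha.ne', log_div hab.ne' hb.ne'] at key
  have := mul_le_mul_of_nonneg_left key hab.le
  have e1 : (a + b) * (a / (a + b) * (log (a + b) - log a) + b / (a + b) * (log (a + b) - log b))
      = (a + b) * log (a + b) - a * log a - b * log b := by field_simp; ring
  have e2 : (a + b) * (c * (a / (a + b) * (b / (a + b)))) = c * (a * b / (a + b)) := by
    field_simp
  rw [e1, e2] at this
  linarith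

/-- The variance-like quantity `a * b / (a + b)` is superadditive. -/
lemma mul_div_add_superadditive {a₁ b₁ a₂ b₂ : ℝ} (h₁ : 0 < a₁ + b₁) (h₂ : 0 < a₂ + b₂) :
    a₁ * b₁ / (a₁ + b₁) + a₂ * b₂ / (a₂ + b₂) ≤
      (a₁ + a₂) * (b₁ + b₂) / ((a₁ + b₁) + (a₂ + b₂)) := by
  rw [div_add_div _ _ h₁.ne' h₂.ne', div_le_div_iff₀ (by positivity) (by positivity)]
  have : 0 ≤ (a₁ * b₂ - a₂ * b₁) ^ 2 := sq_nonneg _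
  nlinarith

/-- A partial order on a finite type all of whose chains in `A` have at most `r` elements
partitions `A` into `r` antichains. -/
lemma exists_antichain_coloring {α : Type*} [Finite α] [DecidableEq α] (R : α → α → Prop)
    (htrans : ∀ x y z, R x y → R y z → R x z) (hirrefl : ∀ x, ¬ R x x) (r : ℕ) (A : Finset α)
    (hA : ∀ C ⊆ A, C.card = r + 1 → ¬ (C : Set α).Pairwise fun x y => R x y ∨ R y x) :
    ∃ c : α → ℕ, (∀ x ∈ A, c x < r) ∧ ∀ x ∈ A, ∀ y ∈ A, c x = c y → ¬ R x y := by
  classical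
  induction r generalizing A with
  | zero =>
    have hempty : ∀ x, x ∉ A := fun x hx =>
      hA {x} (by simpa using hx) (by simp) (by simp)
    exact ⟨fun _ => 0, fun x hx => absurd hx (hempty x), fun x hx => absurd hx (hempty x)⟩
  | succ r ih =>
    obtain ⟨c, hc, hc'⟩ := ih (A.filter fun x => ∃ y ∈ A, R y x) (by
      intro C hC hcard hchain
      have : IsTrans α R := ⟨htrans⟩
      have : Std.Irrefl R := ⟨hirrefl⟩
      have hne : C.Nonempty := Finset.card_pos.1 (by omega)
      obtain ⟨x, hxC, hmin⟩ := (Finite.wellFounded_of_trans_of_irrefl R).has_min (C : Set α) hne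
      obtain ⟨-, y, hyA, hyx⟩ := Finset.mem_filter.1 (hC hxC)
      have hyC : y ∉ C := fun hy => hmin y hy hyx
      refine hA (insert y C) ?_ (by rw [Finset.card_insert_of_notMem hyC, hcard]) ?_
      · exact Finset.insert_subset hyA (hC.trans (Finset.filter_subset _ _))
      · have hy : ∀ z ∈ C, R y z := by
          intro z hz
          by_cases hzx : z = x
          · exact hzx ▸ hyx
          · exact htrans _ _ _ hyx ((hchain hz hxC hzx).resolve_left (hmin z hz))
        rw [Finset.coe_insert]
        exact hchain.insert fun z hz _ => ⟨Or.inl (hy z hz), Or.inr (hy z hz)⟩)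
    refine ⟨fun x => if ∃ y ∈ A, R y x then c x else r, ?_, ?_⟩
    · intro x hx
      dsimp only
      split_ifs with h
      · exact (hc x (Finset.mem_filter.2 ⟨hx, h⟩)).trans (Nat.lt_succ_self r)
      · exact Nat.lt_succ_self r
    · intro x hx y hy hxy hR
      have hy' : ∃ z ∈ A, R z y := ⟨x, hx, hR⟩
      have hcy := hc y (Finset.mem_filter.2 ⟨hy, hy'⟩)
      simp only [hy', if_true] at hxy
      split_ifs at hxy with h
      · exact hc' x (Finset.mem_filter.2 ⟨hx, h⟩) y (Finset.mem_filter.2 ⟨hy, hy'⟩) hxy hR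
      · omega

open Real in
/-- If every large subfamily of a family of two-colourings is split by some point in proportion
at least `1 / q`, then the size of the family is controlled by its total variance. -/
lemma card_mul_log_le_variance {ι X : Type*} [DecidableEq ι] [Fintype X] [DecidableEq X]
    (f : ι → X → Bool) {q c m₀ : ℝ} (hq : 0 < q) (hc : 0 < c) (hm₀ : 0 < m₀)
    (h : binEntropy (1 / q) ≤ c * (1 / q * (1 - 1 / q))) (W : Finset ι)
    (hsplit : ∀ W' ⊆ W, m₀ < W'.card → ∃ x,
      (W'.card : ℝ) ≤ q * (W'.filter (f · x = true)).card ∧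
      (W'.card : ℝ) ≤ q * (W'.filter (f · x = false)).card) :
    (W.card : ℝ) * log (W.card / m₀) ≤
      c * ∑ x, ((W.filter (f · x = true)).card : ℝ) * (W.filter (f · x = false)).card / W.card := by
  have hcard : ∀ (V : Finset ι) x, ((V.filter (f · x = true)).card : ℝ) +
      (V.filter (f · x = false)).card = V.card := by
    intro V x
    have := Finset.card_filter_add_card_filter_not (s := V) (f · x = true)
    simp only [Bool.not_eq_true] at this
    exact_mod_cast this
  induction W using Finset.strongInduction with
  | H W ih =>
    rcases le_or_gt (W.card : ℝ) m₀ with hm | hm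
    · have h1 : (W.card : ℝ) * log (W.card / m₀) ≤ 0 :=
        mul_nonpos_of_nonneg_of_nonpos (by positivity)
          (log_nonpos (by positivity) ((div_le_one hm₀).2 hm))
      exact h1.trans (by positivity)
    · have hWpos : (0 : ℝ) < W.card := hm₀.trans hm
      obtain ⟨x₀, hA, hB⟩ := hsplit W subset_rfl hm
      set A := W.filter (f · x₀ = true) with hAdef
      set B := W.filter (f · x₀ = false) with hBdef
      have hAB : (A.card : ℝ) + B.card = W.card := hcard W x₀
      have hApos : (0 : ℝ) < A.card := pos_of_mul_pos_right (hWpos.trans_le hA) hq.le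
      have hBpos : (0 : ℝ) < B.card := pos_of_mul_pos_right (hWpos.trans_le hB) hq.le
      have hAW : A ⊆ W := Finset.filter_subset _ _
      have hBW : B ⊆ W := Finset.filter_subset _ _
      have hAss : A ⊂ W := by
        refine hAW.ssubset_of_ne fun he => ?_
        rw [he] at hAB; linarith
      have hBss : B ⊂ W := by
        refine hBW.ssubset_of_ne fun he => ?_
        rw [he] at hAB; linarith
      have ihA := ih A hAss fun V hV => hsplit V (hV.trans hAW)
      have ihB := ih B hBss fun V hV => hsplit V (hV.trans hBW)
      have hsum : ∀ x b, ((W.filter (f · x = b)).card : ℝ) =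
          (A.filter (f · x = b)).card + (B.filter (f · x = b)).card := by
        intro x b
        have hU : A ∪ B = W := by
          ext v; cases hv : f v x₀ <;> simp [hAdef, hBdef, hv]
        have hD : Disjoint A B := by
          rw [Finset.disjoint_left]; intro v hv hv'
          simp [hAdef, hBdef] at hv hv'; simp [hv.2] at hv'
        rw [← hU, Finset.filter_union,
          Finset.card_union_of_disjoint (Finset.disjoint_filter_filter hD)]
        push_cast; rfl
      have hpoint : ∀ x, ((A.filter (f · x = true)).card : ℝ) * (A.filter (f · x = false)).card
            / A.card + ((B.filter (f · x = true)).card : ℝ) * (B.filter (f · x = false)).card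
            / B.card + (if x = x₀ then (A.card : ℝ) * B.card / W.card else 0) ≤
          ((W.filter (f · x = true)).card : ℝ) * (W.filter (f · x = false)).card / W.card := by
        intro x
        split_ifs with hx
        · subst hx
          have e1 : A.filter (f · x = false) = ∅ := by
            ext v; simp +contextual [hAdef]
          have e2 : B.filter (f · x = true) = ∅ := by
            ext v; simp +contextual [hBdef]
          simp [e1, e2]
          exact le_rfl
        · have key := mul_div_add_superadditive
            (a₁ := (A.filter (f · x = true)).card) (b₁ := (A.filter (f · x = false)).card)
            (a₂ := (B.filter (f · x = true)).card) (b₂ := (B.filter (f · x = false)).card)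
            (by rw [hcard A x]; exact hApos) (by rw [hcard B x]; exact hBpos)
          rw [hcard A x, hcard B x, hAB, ← hsum x true, ← hsum x false] at key
          rw [add_zero]
          exact key
      have hS := Finset.sum_le_sum fun x (_ : x ∈ Finset.univ) => hpoint x
      rw [Finset.sum_add_distrib, Finset.sum_add_distrib, Finset.sum_ite_eq' Finset.univ x₀,
        if_pos (Finset.mem_univ _)] at hS
      have hS' := mul_le_mul_of_nonneg_left hS hc.le
      have key := split_log_le hApos hBpos hq hc h (hAB ▸ hA) (hAB ▸ hB)
      rw [log_div hApos.ne' hm₀.ne'] at ihA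
      rw [log_div hBpos.ne' hm₀.ne'] at ihB
      rw [log_div hWpos.ne' hm₀.ne']
      rw [hAB] at key
      have e : (W.card : ℝ) * log m₀ = A.card * log m₀ + B.card * log m₀ := by rw [← hAB]; ring
      nlinarith

/-- Double counting of the triples `(x, v, w)` such that `L v` and `L w` take different values
at `x`. -/
lemma sum_card_mul_card_le {ι : Type*} [Fintype ι] [DecidableEq ι] (L : ι → ι → Bool)
    (W : Finset ι) (d : ℕ)
    (hd : ∀ v ∈ W, ∀ w ∈ W,
      (Finset.univ.filter fun x => (v ≠ x ∧ L v x = true) ∧ w ≠ x ∧ L w x = false).card ≤ d) :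
    ∑ x, (W.filter fun v => v ≠ x ∧ L v x = true).card *
      (W.filter fun v => v ≠ x ∧ L v x = false).card ≤ W.card * (W.card - 1) * d := by
  calc
    _ = ∑ x, ∑ p ∈ W ×ˢ W, if (p.1 ≠ x ∧ L p.1 x = true) ∧ p.2 ≠ x ∧ L p.2 x = false
          then 1 else 0 := by
        refine Finset.sum_congr rfl fun x _ => ?_
        rw [← Finset.card_product, ← Finset.filter_product, Finset.card_filter]
    _ = ∑ p ∈ W ×ˢ W, (Finset.univ.filter fun x =>
          (p.1 ≠ x ∧ L p.1 x = true) ∧ p.2 ≠ x ∧ L p.2 x = false).card := by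
        rw [Finset.sum_comm]
        exact Finset.sum_congr rfl fun p _ => (Finset.card_filter _ _).symm
    _ ≤ ∑ p ∈ W ×ˢ W, if p.1 ≠ p.2 then d else 0 := by
        refine Finset.sum_le_sum fun p hpW => ?_
        obtain ⟨h1, h2⟩ := Finset.mem_product.1 hpW
        split_ifs with hp
        · exact hd _ h1 _ h2
        · rw [not_not] at hp
          rw [Nat.le_zero, Finset.card_eq_zero, Finset.filter_eq_empty_iff]
          rintro x - ⟨⟨-, h1⟩, -, h2⟩
          rw [hp, h2] at h1
          exact Bool.false_ne_true h1
    _ = W.card * (W.card - 1) * d := by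
        rw [← Finset.sum_filter, Finset.sum_const, smul_eq_mul,
          show (W ×ˢ W).filter (fun p => p.1 ≠ p.2) = W.offDiag by
            ext ⟨a, b⟩; simp [Finset.mem_offDiag, and_assoc],
          Finset.offDiag_card, Nat.mul_sub_one]

/-- Colourings `L v` that are only meaningful away from `v` can be completed at `v` by majority
vote with little effect on their total variance. -/
lemma exists_completion_variance_le {ι : Type*} [Fintype ι] [DecidableEq ι] (L : ι → ι → Bool)
    (W : Finset ι) (hW : 2 ≤ W.card) (d : ℕ)
    (hd : ∀ v ∈ W, ∀ w ∈ W,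
      (Finset.univ.filter fun x => (v ≠ x ∧ L v x = true) ∧ w ≠ x ∧ L w x = false).card ≤ d) :
    ∃ f : ι → ι → Bool, (∀ v x, v ≠ x → f v x = L v x) ∧
      ∑ x, ((W.filter (f · x = true)).card : ℝ) * (W.filter (f · x = false)).card / W.card ≤
        d * (W.card + 1) := by
  set a : ι → ℕ := fun x => (W.filter fun v => v ≠ x ∧ L v x = true).card with ha
  set b : ι → ℕ := fun x => (W.filter fun v => v ≠ x ∧ L v x = false).card with hb
  have hsum : ∑ x, (a x : ℝ) * b x ≤ W.card * (W.card - 1) * d := by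
    have := sum_card_mul_card_le L W d hd
    have h' : ((∑ x, a x * b x : ℕ) : ℝ) ≤ ((W.card * (W.card - 1) * d : ℕ) : ℝ) := by
      exact_mod_cast this
    push_cast [Nat.cast_sub (show 1 ≤ W.card by omega)] at h'
    exact h'
  set f : ι → ι → Bool := fun v x => if v = x then decide (b x ≤ a x) else L v x with hf
  have hfne : ∀ v x, v ≠ x → f v x = L v x := fun v x hvx => by simp [hf, hvx]
  refine ⟨f, hfne, ?_⟩
  have hcount : ∀ x β, (W.filter (f · x = β)).card =
      (W.filter fun v => v ≠ x ∧ L v x = β).card +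
        if x ∈ W ∧ decide (b x ≤ a x) = β then 1 else 0 := by
    intro x β
    rw [← Finset.card_filter_add_card_filter_not (s := W.filter (f · x = β)) (· ≠ x),
      Finset.filter_filter, Finset.filter_filter]
    congr 1
    · congr 1
      ext v
      by_cases hv : v = x <;> simp [hf, hv]
    · have : (W.filter fun v => f v x = β ∧ ¬ v ≠ x) =
          if x ∈ W ∧ decide (b x ≤ a x) = β then {x} else ∅ := by
        ext v
        by_cases hv : v = x
        · subst hv
          split_ifs with h <;> simpa [hf] using h
        · split_ifs <;> simp [hv]
      rw [this]
      split_ifs <;> simp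
  have hm : (2 : ℝ) ≤ W.card := by exact_mod_cast hW
  have hpoint : ∀ x, (W.card - 1 : ℝ) *
      (((W.filter (f · x = true)).card : ℝ) * (W.filter (f · x = false)).card) ≤
        (W.card + 1) * (a x * b x) := by
    intro x
    rw [hcount, hcount]
    change (W.card - 1 : ℝ) * (((a x + _ : ℕ) : ℝ) * ((b x + _ : ℕ) : ℝ)) ≤ _
    have ha0 : (0 : ℝ) ≤ a x := Nat.cast_nonneg _
    have hb0 : (0 : ℝ) ≤ b x := Nat.cast_nonneg _
    by_cases hx : x ∈ W
    · have hab : (a x : ℝ) + b x = W.card - 1 := by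
        have h1 := Finset.card_erase_add_one hx
        have h2 := Finset.card_filter_add_card_filter_not (s := W.erase x) (L · x = true)
        have e1 : (W.erase x).filter (L · x = true) = W.filter fun v => v ≠ x ∧ L v x = true := by
          ext v; simp; tauto
        have e2 : (W.erase x).filter (fun v => ¬ L v x = true) =
            W.filter fun v => v ≠ x ∧ L v x = false := by
          ext v; simp; tauto
        rw [e1, e2] at h2
        have h3 : a x + b x + 1 = W.card := by rw [← h1, ← h2]
        rw [eq_sub_iff_add_eq]
        exact_mod_cast h3
      by_cases hle : b x ≤ a x
      · have hle' : (b x : ℝ) ≤ a x := by exact_mod_cast hle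
        simp only [hx, hle, decide_true, and_self, if_true, Bool.true_eq_false, and_false,
          if_false, add_zero, Nat.cast_add, Nat.cast_one, ← hab]
        rw [show (W.card : ℝ) + 1 = a x + b x + 2 by linarith]
        nlinarith [mul_nonneg hb0 (sub_nonneg.2 hle')]
      · have hle' : (a x : ℝ) ≤ b x := by exact_mod_cast (not_le.1 hle).le
        simp only [hx, hle, decide_false, and_self, if_true, Bool.false_eq_true, and_false,
          if_false, add_zero, Nat.cast_add, Nat.cast_one, ← hab]
        rw [show (W.card : ℝ) + 1 = a x + b x + 2 by linarith]
        nlinarith [mul_nonneg ha0 (sub_nonneg.2 hle')]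
    · simp only [hx, false_and, if_false, add_zero]
      nlinarith [mul_nonneg ha0 hb0]
  rw [← Finset.sum_div, div_le_iff₀ (by linarith)]
  have h1 := Finset.sum_le_sum fun x (_ : x ∈ Finset.univ) => hpoint x
  rw [← Finset.mul_sum, ← Finset.mul_sum] at h1
  have h2 := mul_le_mul_of_nonneg_left hsum (show (0 : ℝ) ≤ W.card + 1 by linarith)
  refine le_of_mul_le_mul_left (h1.trans (h2.trans (le_of_eq ?_)))
    (show (0 : ℝ) < W.card - 1 by linarith)
  ring

/-- The colouring `c` covers `π` with the point `v` deleted. -/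
def IsCoverOff {n : ℕ} (π : Equiv.Perm (Fin n)) {r s : ℕ} (v : Fin n)
    (c : Fin n → Fin r ⊕ Fin s) : Prop :=
  (∀ a : Fin r, IsIncOn π {i | v ≠ i ∧ c i = Sum.inl a}) ∧
    ∀ b : Fin s, IsDecOn π {i | v ≠ i ∧ c i = Sum.inr b}

lemma KCritical.exists_isCoverOff {n k : ℕ} {π : Equiv.Perm (Fin n)} (hk : 0 < k)
    (h : KCritical π k) (v : Fin n) :
    ∃ r s, r + s = k ∧ ∃ c : Fin n → Fin r ⊕ Fin s, IsCoverOff π v c := by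
  obtain _ | m := n
  · exact v.elim0
  let τ : Equiv.Perm (Fin m) := (finSuccAboveEquiv v).trans
    ((π.subtypeEquiv fun x => by simp).trans (finSuccAboveEquiv (π v)).symm)
  have hτ : ∀ i, (π v).succAbove (τ i) = π (v.succAbove i) := by
    intro i
    have h1 : finSuccAboveEquiv (π v) (τ i) =
        (π.subtypeEquiv fun x => by simp) (finSuccAboveEquiv v i) := Equiv.apply_symm_apply _ _
    exact congrArg Subtype.val h1
  have hlt : ∀ i j, τ i < τ j ↔ π (v.succAbove i) < π (v.succAbove j) := by
    intro i j
    rw [← hτ, ← hτ, (Fin.strictMono_succAbove _).lt_iff_lt]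
  obtain ⟨r, s, hrs, c, hinc, hdec⟩ := h.2 m τ
    ⟨Nat.lt_succ_self m, v.succAbove, Fin.strictMono_succAbove v, hlt⟩
  have : Nonempty (Fin r ⊕ Fin s) := by
    rcases Nat.eq_zero_or_pos r with hr | hr
    · exact ⟨Sum.inr ⟨0, by omega⟩⟩
    · exact ⟨Sum.inl ⟨0, hr⟩⟩
  refine ⟨r, s, hrs, v.insertNth (Classical.arbitrary _) c, ?_, ?_⟩
  · rintro a i ⟨hi, hci⟩ j ⟨hj, hcj⟩ hij
    obtain ⟨i, rfl⟩ := Fin.exists_succAbove_eq hi.symm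
    obtain ⟨j, rfl⟩ := Fin.exists_succAbove_eq hj.symm
    rw [Fin.insertNth_apply_succAbove] at hci hcj
    exact (hlt _ _).1 (hinc a i hci j hcj ((Fin.strictMono_succAbove v).lt_iff_lt.1 hij))
  · rintro b i ⟨hi, hci⟩ j ⟨hj, hcj⟩ hij
    obtain ⟨i, rfl⟩ := Fin.exists_succAbove_eq hi.symm
    obtain ⟨j, rfl⟩ := Fin.exists_succAbove_eq hj.symm
    rw [Fin.insertNth_apply_succAbove] at hci hcj
    exact (hlt _ _).1 (hdec b i hci j hcj ((Fin.strictMono_succAbove v).lt_iff_lt.1 hij))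

/-- If `π` is not `(r,s)`-coverable, every two-colouring of its points has a long decreasing
subsequence in the first colour or a long increasing one in the second. -/
lemma exists_isDecOn_or_isIncOn {n r s : ℕ} {π : Equiv.Perm (Fin n)} (h : ¬ Coverable π r s)
    (g : Fin n → Bool) :
    (∃ C : Finset (Fin n), C.card = r + 1 ∧ (∀ x ∈ C, g x = true) ∧ IsDecOn π C) ∨
      ∃ C : Finset (Fin n), C.card = s + 1 ∧ (∀ x ∈ C, g x = false) ∧ IsIncOn π C := by
  by_contra! hcon
  obtain ⟨hD, hI⟩ := hcon
  obtain ⟨c₁, hc₁, hc₁'⟩ := exists_antichain_coloring (fun x y : Fin n => x < y ∧ π y < π x)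
    (fun x y z h1 h2 => ⟨h1.1.trans h2.1, h2.2.trans h1.2⟩) (fun x hx => lt_irrefl _ hx.1) r
    (Finset.univ.filter (g · = true)) (by
      intro C hC hcard hchain
      refine hD C hcard (fun x hx => (Finset.mem_filter.1 (hC hx)).2) fun i hi j hj hij => ?_
      rcases hchain hi hj hij.ne with h1 | h1
      · exact h1.2
      · exact absurd h1.1 hij.asymm)
  obtain ⟨c₂, hc₂, hc₂'⟩ := exists_antichain_coloring (fun x y : Fin n => x < y ∧ π x < π y)
    (fun x y z h1 h2 => ⟨h1.1.trans h2.1, h1.2.trans h2.2⟩) (fun x hx => lt_irrefl _ hx.1) s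
    (Finset.univ.filter (g · = false)) (by
      intro C hC hcard hchain
      refine hI C hcard (fun x hx => (Finset.mem_filter.1 (hC hx)).2) fun i hi j hj hij => ?_
      rcases hchain hi hj hij.ne with h1 | h1
      · exact h1.2
      · exact absurd h1.1 hij.asymm)
  have hmem : ∀ x β, g x = β → x ∈ Finset.univ.filter (g · = β) := fun x β hx => by simpa using hx
  let c : Fin n → Fin r ⊕ Fin s := fun x =>
    if hx : g x = true then Sum.inl ⟨c₁ x, hc₁ x (hmem x _ hx)⟩
    else Sum.inr ⟨c₂ x, hc₂ x (hmem x _ (Bool.not_eq_true _ ▸ hx))⟩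
  have hl : ∀ x a, c x = Sum.inl a → g x = true ∧ c₁ x = a := by
    intro x a hx
    by_cases hg : g x = true
    · simp only [c, hg, dite_true, Sum.inl.injEq] at hx
      exact ⟨hg, congrArg Fin.val hx⟩
    · simp [c, hg] at hx
  have hr : ∀ x b, c x = Sum.inr b → g x = false ∧ c₂ x = b := by
    intro x b hx
    by_cases hg : g x = true
    · simp [c, hg] at hx
    · simp only [c] at hx
      rw [dif_neg hg] at hx
      exact ⟨Bool.eq_false_of_not_eq_true hg, congrArg Fin.val (Sum.inr.inj hx)⟩
  refine h ⟨c, ?_, ?_⟩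
  · intro a i hi j hj hij
    obtain ⟨hgi, hi⟩ := hl i a hi
    obtain ⟨hgj, hj⟩ := hl j a hj
    refine lt_of_le_of_ne (not_lt.1 fun hlt => ?_) (π.injective.ne hij.ne)
    exact hc₁' i (hmem i _ hgi) j (hmem j _ hgj) (hi.trans hj.symm) ⟨hij, hlt⟩
  · intro b i hi j hj hij
    obtain ⟨hgi, hi⟩ := hr i b hi
    obtain ⟨hgj, hj⟩ := hr j b hj
    refine lt_of_le_of_ne (not_lt.1 fun hlt => ?_) (π.injective.ne hij.ne')
    exact hc₂' i (hmem i _ hgi) j (hmem j _ hgj) (hi.trans hj.symm) ⟨hij, hlt⟩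

namespace IsCoverOff

variable {n r s : ℕ} {π : Equiv.Perm (Fin n)}

/-- Increasing classes meet decreasing subsequences in at most one point. -/
lemma card_le_of_isDecOn {v : Fin n} {c : Fin n → Fin r ⊕ Fin s} (h : IsCoverOff π v c)
    {C : Finset (Fin n)} (hC : IsDecOn π C) (hv : v ∉ C) (hl : ∀ x ∈ C, (c x).isLeft = true) :
    C.card ≤ r := by
  have hinj : Set.InjOn c C := by
    intro x hx y hy hxy
    have hvx : v ≠ x := fun e => hv (e ▸ hx)
    have hvy : v ≠ y := fun e => hv (e ▸ hy)
    obtain ⟨a, ha⟩ := Sum.isLeft_iff.1 (hl x hx)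
    rcases lt_trichotomy x y with hlt | heq | hlt
    · exact absurd (h.1 a x ⟨hvx, ha⟩ y ⟨hvy, hxy ▸ ha⟩ hlt)
        (hC x hx y hy hlt).asymm
    · exact heq
    · exact absurd (h.1 a y ⟨hvy, hxy ▸ ha⟩ x ⟨hvx, ha⟩ hlt)
        (hC y hy x hx hlt).asymm
  have himage : C.image c ⊆ Finset.univ.image (Sum.inl : Fin r → Fin r ⊕ Fin s) := by
    intro y hy
    obtain ⟨x, hx, rfl⟩ := Finset.mem_image.1 hy
    obtain ⟨a, ha⟩ := Sum.isLeft_iff.1 (hl x hx)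
    exact Finset.mem_image.2 ⟨a, Finset.mem_univ _, ha.symm⟩
  rw [← Finset.card_image_of_injOn hinj]
  exact (Finset.card_le_card himage).trans (Finset.card_image_le.trans (by simp))

/-- Decreasing classes meet increasing subsequences in at most one point. -/
lemma card_le_of_isIncOn {v : Fin n} {c : Fin n → Fin r ⊕ Fin s} (h : IsCoverOff π v c)
    {C : Finset (Fin n)} (hC : IsIncOn π C) (hv : v ∉ C) (hl : ∀ x ∈ C, (c x).isLeft = false) :
    C.card ≤ s := by
  have hinj : Set.InjOn c C := by
    intro x hx y hy hxy
    have hvx : v ≠ x := fun e => hv (e ▸ hx)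
    have hvy : v ≠ y := fun e => hv (e ▸ hy)
    obtain ⟨b, hb⟩ := Sum.isRight_iff.1 (Sum.isLeft_eq_false.1 (hl x hx))
    rcases lt_trichotomy x y with hlt | heq | hlt
    · exact absurd (h.2 b x ⟨hvx, hb⟩ y ⟨hvy, hxy ▸ hb⟩ hlt)
        (hC x hx y hy hlt).asymm
    · exact heq
    · exact absurd (h.2 b y ⟨hvy, hxy ▸ hb⟩ x ⟨hvx, hb⟩ hlt)
        (hC y hy x hx hlt).asymm
  have himage : C.image c ⊆ Finset.univ.image (Sum.inr : Fin s → Fin r ⊕ Fin s) := by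
    intro y hy
    obtain ⟨x, hx, rfl⟩ := Finset.mem_image.1 hy
    obtain ⟨b, hb⟩ := Sum.isRight_iff.1 (Sum.isLeft_eq_false.1 (hl x hx))
    exact Finset.mem_image.2 ⟨b, Finset.mem_univ _, hb.symm⟩
  rw [← Finset.card_image_of_injOn hinj]
  exact (Finset.card_le_card himage).trans (Finset.card_image_le.trans (by simp))

/-- The increasing part of one cover and the decreasing part of another share few points. -/
lemma card_inter_le {v w : Fin n} {c d : Fin n → Fin r ⊕ Fin s} (hc : IsCoverOff π v c)
    (hd : IsCoverOff π w d) :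
    (Finset.univ.filter fun x =>
      (v ≠ x ∧ (c x).isLeft = true) ∧ w ≠ x ∧ (d x).isLeft = false).card ≤ r * s := by
  set S := Finset.univ.filter fun x =>
    (v ≠ x ∧ (c x).isLeft = true) ∧ w ≠ x ∧ (d x).isLeft = false with hS
  have hmem : ∀ x ∈ S, (v ≠ x ∧ (c x).isLeft = true) ∧ w ≠ x ∧ (d x).isLeft = false :=
    fun x hx => (Finset.mem_filter.1 hx).2
  refine (Finset.card_le_mul_card_image_of_maps_to (f := d) (t := Finset.univ.image Sum.inr)
    (fun x hx => ?_) r fun y hy => ?_).trans ?_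
  · obtain ⟨b, hb⟩ := Sum.isRight_iff.1 (Sum.isLeft_eq_false.1 (hmem x hx).2.2)
    exact Finset.mem_image.2 ⟨b, Finset.mem_univ _, hb.symm⟩
  · obtain ⟨b, -, rfl⟩ := Finset.mem_image.1 hy
    refine hc.card_le_of_isDecOn ?_ ?_ ?_
    · intro i hi j hj
      rw [Finset.mem_coe, Finset.mem_filter] at hi hj
      exact hd.2 b i ⟨(hmem i hi.1).2.1, hi.2⟩ j ⟨(hmem j hj.1).2.1, hj.2⟩
    · exact fun hv => (hmem v (Finset.mem_filter.1 hv).1).1.1 rfl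
    · exact fun x hx => (hmem x (Finset.mem_filter.1 hx).1).1.2
  · exact Nat.mul_le_mul_left r (Finset.card_image_le.trans (by simp))

end IsCoverOff

/-- Covers of the deletions of a non-coverable permutation, completed arbitrarily at the deleted
point, are split evenly by some point as soon as there are many of them. -/
lemma exists_balanced_point {n r s t : ℕ} {π : Equiv.Perm (Fin n)} (h : ¬ Coverable π r s)
    (hr : r + 1 ≤ t) (hs : s + 1 ≤ t) {c : Fin n → Fin n → Fin r ⊕ Fin s}
    {f : Fin n → Fin n → Bool} (hf : ∀ v x, v ≠ x → f v x = (c v x).isLeft)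
    (W : Finset (Fin n)) (hc : ∀ v ∈ W, IsCoverOff π v (c v)) (hW : t * (t + 1) < W.card) :
    ∃ x, W.card ≤ (t + 1) * (W.filter (f · x = true)).card ∧
      W.card ≤ (t + 1) * (W.filter (f · x = false)).card := by
  by_contra! hcon
  set g : Fin n → Bool := fun x => decide ((t + 1) * (W.filter (f · x = false)).card < W.card)
    with hg
  have hfew : ∀ x, (t + 1) * (W.filter (f · x = !g x)).card < W.card := by
    intro x
    by_cases hx : (t + 1) * (W.filter (f · x = false)).card < W.card
    · have : g x = true := by simp [hg, hx]
      rw [this]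
      exact hx
    · have : g x = false := by simpa [hg] using hx
      rw [this]
      by_contra hx'
      exact hx (hcon x (not_lt.1 hx'))
  have hgood : ∀ C : Finset (Fin n), C.card ≤ t →
      ∃ v ∈ W, v ∉ C ∧ ∀ x ∈ C, (c v x).isLeft = g x := by
    intro C hC
    set B := C.biUnion fun x => insert x (W.filter (f · x = !g x)) with hB
    have hBcard : B.card < W.card := by
      have h1 : (t + 1) * B.card ≤ C.card * (W.card + t) := by
        calc (t + 1) * B.card
            ≤ (t + 1) * ∑ x ∈ C, (insert x (W.filter (f · x = !g x))).card :=
              Nat.mul_le_mul_left _ Finset.card_biUnion_le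
          _ = ∑ x ∈ C, (t + 1) * (insert x (W.filter (f · x = !g x))).card := Finset.mul_sum _ _ _
          _ ≤ ∑ x ∈ C, (W.card + t) := by
              refine Finset.sum_le_sum fun x _ => ?_
              have h2 := Finset.card_insert_le x (W.filter (f · x = !g x))
              have h3 := Nat.mul_le_mul_left (t + 1) h2
              have h4 := hfew x
              rw [mul_add] at h3
              omega
          _ = C.card * (W.card + t) := by rw [Finset.sum_const, smul_eq_mul]
      have h2 := Nat.mul_le_mul_right (W.card + t) hC
      nlinarith
    obtain ⟨v, hvW, hvB⟩ := Finset.exists_mem_notMem_of_card_lt_card hBcard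
    simp only [hB, Finset.mem_biUnion, Finset.mem_insert, Finset.mem_filter, not_exists,
      not_and, not_or] at hvB
    have hvC : v ∉ C := fun hv => (hvB v hv).1 rfl
    refine ⟨v, hvW, hvC, fun x hx => ?_⟩
    rw [← hf v x fun e => hvC (e ▸ hx)]
    simpa using (hvB x hx).2 hvW
  rcases exists_isDecOn_or_isIncOn h g with ⟨C, hcard, hCg, hC⟩ | ⟨C, hcard, hCg, hC⟩
  · obtain ⟨v, hvW, hvC, hv⟩ := hgood C (by omega)
    have := (hc v hvW).card_le_of_isDecOn hC hvC fun x hx => (hv x hx).trans (hCg x hx)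
    omega
  · obtain ⟨v, hvW, hvC, hv⟩ := hgood C (by omega)
    have := (hc v hvW).card_le_of_isIncOn hC hvC fun x hx => (hv x hx).trans (hCg x hx)
    omega

/-- A bound on the number of points whose deletion makes a permutation `(r,s)`-coverable. -/
lemma card_le_of_isCoverOff {n r s t : ℕ} {π : Equiv.Perm (Fin n)} (h : ¬ Coverable π r s)
    (ht : 3 ≤ t) (hr : r + 1 ≤ t) (hs : s + 1 ≤ t) {β : ℝ} (hβ : 1 < β)
    (hent : Real.binEntropy (1 / ((t : ℝ) + 1)) ≤
      Real.log β * (1 / ((t : ℝ) + 1) * (1 - 1 / ((t : ℝ) + 1))))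
    (W : Finset (Fin n)) (hW : ∀ v ∈ W, ∃ c : Fin n → Fin r ⊕ Fin s, IsCoverOff π v c) :
    (W.card : ℝ) ≤ 11 / 10 * (t * (t + 1)) * β ^ (r * s) := by
  have ht' : (3 : ℝ) ≤ t := by exact_mod_cast ht
  have hpow : 1 ≤ β ^ (r * s) := one_le_pow₀ hβ.le
  have hm₀ : (12 : ℝ) ≤ t * (t + 1) := by nlinarith
  rcases lt_or_ge W.card 2 with hW₂ | hW₂
  · have : (W.card : ℝ) ≤ 1 := by exact_mod_cast (by omega : W.card ≤ 1)
    nlinarith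
  have hne : Nonempty (Fin n → Fin r ⊕ Fin s) := by
    obtain ⟨v, hv⟩ := Finset.card_pos.1 (by omega : 0 < W.card)
    exact ⟨(hW v hv).choose⟩
  choose! c hc using hW
  obtain ⟨f, hf, hvar⟩ := exists_completion_variance_le (fun v x => (c v x).isLeft) W hW₂ (r * s)
    fun v hv w hw => (hc v hv).card_inter_le (hc w hw)
  have hlogβ : 0 < Real.log β := Real.log_pos hβ
  have hmain := card_mul_log_le_variance f (q := (t : ℝ) + 1) (by positivity) hlogβ
    (m₀ := t * (t + 1)) (by positivity) hent W (by
      intro W' hW' hcard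
      obtain ⟨x, h1, h2⟩ := exists_balanced_point h hr hs hf W' (fun v hv => hc v (hW' hv))
        (by exact_mod_cast hcard)
      exact ⟨x, by exact_mod_cast h1, by exact_mod_cast h2⟩)
  replace hmain := hmain.trans (mul_le_mul_of_nonneg_left hvar hlogβ.le)
  by_contra! hlt
  have hWpos : (0 : ℝ) < W.card := by positivity
  set x := Real.log β * (r * s : ℕ) with hx
  have hx0 : 0 ≤ x := by positivity
  have hexp : β ^ (r * s) = Real.exp x := by
    rw [hx, mul_comm (Real.log β), Real.exp_nat_mul, Real.exp_log (by linarith)]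
  rw [hexp] at hlt
  have h1 : Real.log (11 / 10) + x < Real.log (W.card / (t * (t + 1))) := by
    rw [← Real.log_exp x, ← Real.log_mul (by norm_num) (Real.exp_pos _).ne']
    refine Real.log_lt_log (by positivity) ?_
    rw [lt_div_iff₀ (by positivity)]
    linarith
  have h2 : (1 : ℝ) / 11 ≤ Real.log (11 / 10) := by
    have := Real.one_sub_inv_le_log_of_pos (show (0 : ℝ) < 11 / 10 by norm_num)
    norm_num at this ⊢
    exact this
  have h3 : (W.card : ℝ) * (1 / 11 + x) ≤ x * (W.card + 1) := by
    refine le_trans (mul_le_mul_of_nonneg_left (by linarith) hWpos.le) (hmain.trans_eq ?_)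
    rw [hx]
    ring
  have h4 : 12 * (1 + x) ≤ t * (t + 1) * Real.exp x :=
    mul_le_mul hm₀ (by linarith [Real.add_one_le_exp x]) (by linarith) (by linarith)
  linarith

lemma binEntropy_one_div_le {t : ℕ} {β : ℝ} (ht : 1 ≤ t) (hβ : 0 < β)
    (h : ((t : ℝ) + 1) ^ ((t + 1) ^ 2) ≤ β ^ t * (t : ℝ) ^ (t * (t + 1))) :
    Real.binEntropy (1 / ((t : ℝ) + 1)) ≤
      Real.log β * (1 / ((t : ℝ) + 1) * (1 - 1 / ((t : ℝ) + 1))) := by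
  have ht' : (0 : ℝ) < t := by exact_mod_cast ht
  have hlog := Real.log_le_log (by positivity) h
  rw [Real.log_mul (by positivity) (by positivity), Real.log_pow, Real.log_pow, Real.log_pow]
    at hlog
  push_cast at hlog
  have e : 1 - 1 / ((t : ℝ) + 1) = t / (t + 1) := by field_simp; ring
  rw [Real.binEntropy, e, one_div, inv_inv, inv_div, Real.log_div (by positivity) ht'.ne']
  have e1 : ((t : ℝ) + 1)⁻¹ * Real.log (t + 1) + t / (t + 1) * (Real.log (t + 1) - Real.log t) =
      (((t : ℝ) + 1) ^ 2 * Real.log (t + 1) - t * (t + 1) * Real.log t) / (t + 1) ^ 2 := by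
    field_simp; ring
  have e2 : Real.log β * (((t : ℝ) + 1)⁻¹ * (t / (t + 1))) = t * Real.log β / (t + 1) ^ 2 := by
    field_simp
  rw [e1, e2]
  gcongr
  linarith

lemma mul_exp_bound_pow_le {k : ℕ} (hk : 12 ≤ k) :
    ((k : ℝ) + 1) * 2.7183 ^ (k + 2) ≤ 4 ^ k := by
  induction k, hk using Nat.le_induction with
  | base => norm_num
  | succ k hk ih =>
    have hk' : (12 : ℝ) ≤ k := by exact_mod_cast hk
    have hpos : (0 : ℝ) < 2.7183 ^ (k + 2) := by positivity
    rw [show k + 1 + 2 = k + 2 + 1 by ring, pow_succ, pow_succ (4 : ℝ)]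
    push_cast
    nlinarith

lemma succ_pow_sq_le {k : ℕ} (hk : 10 ≤ k) :
    ((k : ℝ) + 1) ^ ((k + 1) ^ 2) ≤ (4 * (k : ℝ)) ^ k * (k : ℝ) ^ (k * (k + 1)) := by
  rcases lt_or_ge k 12 with hlt | hge
  · interval_cases k <;> norm_num
  have hk' : (0 : ℝ) < k := by exact_mod_cast (by omega : 0 < k)
  have hexp : ((k : ℝ) + 1) ^ k ≤ 2.7183 * (k : ℝ) ^ k := by
    have h1 : (1 / (k : ℝ) + 1) ^ k ≤ Real.exp 1 := by
      refine (pow_le_pow_left₀ (by positivity) (Real.add_one_le_exp _) k).trans_eq ?_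
      rw [← Real.exp_nat_mul, mul_one_div_cancel hk'.ne']
    have h2 : (k : ℝ) + 1 = (1 / (k : ℝ) + 1) * k := by field_simp; ring
    rw [h2, mul_pow]
    have := Real.exp_one_lt_d9
    gcongr
    linarith
  calc ((k : ℝ) + 1) ^ ((k + 1) ^ 2) = (k + 1) * (((k : ℝ) + 1) ^ k) ^ (k + 2) := by
        rw [← pow_mul, ← pow_succ']; congr 1; ring
    _ ≤ (k + 1) * (2.7183 * (k : ℝ) ^ k) ^ (k + 2) := by gcongr
    _ = ((k + 1) * 2.7183 ^ (k + 2)) * (k : ℝ) ^ (k * (k + 2)) := by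
        rw [mul_pow, ← pow_mul]; ring
    _ ≤ 4 ^ k * (k : ℝ) ^ (k * (k + 2)) := by gcongr; exact mul_exp_bound_pow_le hge
    _ = (4 * (k : ℝ)) ^ k * (k : ℝ) ^ (k * (k + 1)) := by
        rw [mul_pow, mul_assoc, ← pow_add]; congr 2; ring

/-- The sum over all pairs `(r, k - r)` of the bounds on the number of points, with base `4 * k`. -/
lemma sum_four_mul_pow_le {k : ℕ} (hk : 10 ≤ k) :
    ∑ r ∈ Finset.range (k + 1), (if r * (k - r) = 0 then 11 / 10 * (((k : ℝ) + 1) * (k + 2))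
      else 11 / 10 * ((k : ℝ) * (k + 1)) * (4 * (k : ℝ)) ^ (r * (k - r))) ≤
      (4 * (k : ℝ)) ^ (k ^ 2 / 4 + 2) := by
  have hk' : (10 : ℝ) ≤ k := by exact_mod_cast hk
  obtain ⟨j, hj⟩ : ∃ j, k ^ 2 / 4 = j + 1 :=
    Nat.exists_eq_succ_of_ne_zero (Nat.div_pos (by nlinarith) (by norm_num)).ne'
  have hj1 : 1 ≤ j := by
    have : 8 ≤ k ^ 2 := by nlinarith
    omega
  set Y := (4 * (k : ℝ)) ^ j with hY
  have hY4 : 4 * (k : ℝ) ≤ Y := le_self_pow₀ (by linarith) (by omega)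
  set A := 11 / 10 * ((k : ℝ) * (k + 1)) with hA
  have hA0 : 0 ≤ A := by positivity
  have hY0 : 0 ≤ Y := by positivity
  have hterm : ∀ r ∈ Finset.range (k + 1),
      (if r * (k - r) = 0 then 11 / 10 * (((k : ℝ) + 1) * (k + 2))
        else A * (4 * (k : ℝ)) ^ (r * (k - r))) ≤
      A * Y + ((if r = k / 2 then A * (4 * k * Y) else 0) +
        if r = k - k / 2 then A * (4 * k * Y) else 0) := by
    intro r hr
    have hr : r ≤ k := Nat.lt_succ_iff.1 (Finset.mem_range.1 hr)
    have hnn : ∀ p : Prop, [Decidable p] → 0 ≤ if p then A * (4 * k * Y) else 0 := by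
      intro p _; split_ifs <;> positivity
    have n1 := hnn (r = k / 2)
    have n2 := hnn (r = k - k / 2)
    by_cases h0 : r * (k - r) = 0
    · rw [if_pos h0]
      have : 11 / 10 * (((k : ℝ) + 1) * (k + 2)) ≤ A * Y := by
        rw [hA, mul_assoc, mul_assoc]
        gcongr ?_ * ?_
        nlinarith
      linarith
    · obtain ⟨s, rfl⟩ := Nat.exists_eq_add_of_le hr
      rw [if_neg h0, Nat.add_sub_cancel_left]
      by_cases hmid : r = (r + s) / 2 ∨ r = r + s - (r + s) / 2
      · have hle : r * s ≤ j + 1 := by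
          rw [← hj, Nat.le_div_iff_mul_le (by norm_num)]
          nlinarith [sq_nonneg ((r : ℤ) - s)]
        have hpow : A * (4 * ((r + s : ℕ) : ℝ)) ^ (r * s) ≤ A * (4 * (r + s : ℕ) * Y) := by
          rw [hY, ← pow_succ']
          gcongr
          linarith
        rcases hmid with h | h
        · rw [if_pos h] at n1 ⊢
          nlinarith
        · rw [if_pos h] at n2 ⊢
          nlinarith
      · have hle : r * s ≤ j := by
          have : r * s + 1 ≤ (r + s) ^ 2 / 4 := by
            rw [Nat.le_div_iff_mul_le (by norm_num)]
            have : r + 2 ≤ s ∨ s + 2 ≤ r := by omega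
            rcases this with h | h
            · obtain ⟨d, rfl⟩ := Nat.exists_eq_add_of_le h
              nlinarith
            · obtain ⟨d, rfl⟩ := Nat.exists_eq_add_of_le h
              nlinarith
          omega
        have hpow : A * (4 * ((r + s : ℕ) : ℝ)) ^ (r * s) ≤ A * Y := by
          rw [hY]
          gcongr
          linarith
        linarith
  refine (Finset.sum_le_sum hterm).trans ?_
  rw [Finset.sum_add_distrib, Finset.sum_add_distrib, Finset.sum_ite_eq', Finset.sum_ite_eq',
    if_pos (Finset.mem_range.2 (by omega)), if_pos (Finset.mem_range.2 (by omega)),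
    Finset.sum_const, Finset.card_range, nsmul_eq_mul, hj,
    show j + 1 + 2 = j + 3 by ring, pow_add, ← hY, hA]
  push_cast
  have : ((k : ℝ) + 1) * (11 / 10 * (k * (k + 1))) + 2 * (11 / 10 * (k * (k + 1)) * (4 * k)) ≤
      (4 * k) ^ 3 := by
    nlinarith [mul_nonneg (sq_nonneg (k : ℝ)) (by linarith : (0 : ℝ) ≤ k - 10)]
  nlinarith

/-- A base for which both the entropy condition and the final summation hold. -/
lemma exists_base {k : ℕ} (hk : 3 ≤ k) :
    ∃ β : ℝ, 1 < β ∧ ((k : ℝ) + 1) ^ ((k + 1) ^ 2) ≤ β ^ k * (k : ℝ) ^ (k * (k + 1)) ∧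
      ∑ r ∈ Finset.range (k + 1), (if r * (k - r) = 0 then 11 / 10 * (((k : ℝ) + 1) * (k + 2))
        else 11 / 10 * ((k : ℝ) * (k + 1)) * β ^ (r * (k - r))) ≤
      (4 * (k : ℝ)) ^ (k ^ 2 / 4 + 2) := by
  rcases lt_or_ge k 10 with hlt | hge
  · interval_cases k
    · exact ⟨21, by norm_num [Finset.sum_range_succ]⟩
    · exact ⟨23, by norm_num [Finset.sum_range_succ]⟩
    · exact ⟨26, by norm_num [Finset.sum_range_succ]⟩
    · exact ⟨29, by norm_num [Finset.sum_range_succ]⟩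
    · exact ⟨32, by norm_num [Finset.sum_range_succ]⟩
    · exact ⟨35, by norm_num [Finset.sum_range_succ]⟩
    · exact ⟨38, by norm_num [Finset.sum_range_succ]⟩
  · have hk' : (10 : ℝ) ≤ k := by exact_mod_cast hge
    exact ⟨4 * k, by linarith, succ_pow_sq_le hge, sum_four_mul_pow_le hge⟩

/-- Proposition 15: for `k ≥ 3`, every `k`-critical permutation has length at most
`(4k)^(k²/4 + 2)`. -/
theorem kcritical_length_bound {n : ℕ} (k : ℕ) (hk : 3 ≤ k)
    (π : Equiv.Perm (Fin n)) (h : KCritical π k) :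
    (n : ℝ) ≤ (4 * (k : ℝ)) ^ ((k : ℝ) ^ 2 / 4 + 2) := by
  obtain ⟨β, hβ, hpow, hsum⟩ := exists_base hk
  classical
  set W : ℕ → Finset (Fin n) := fun r =>
    Finset.univ.filter fun v => ∃ c : Fin n → Fin r ⊕ Fin (k - r), IsCoverOff π v c with hW
  have hcover : (Finset.univ : Finset (Fin n)) ⊆ (Finset.range (k + 1)).biUnion W := by
    intro v _
    obtain ⟨r, s, rfl, c, hc⟩ := h.exists_isCoverOff (by omega) v
    refine Finset.mem_biUnion.2 ⟨r, Finset.mem_range.2 (by omega), ?_⟩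
    rw [hW, Finset.mem_filter, Nat.add_sub_cancel_left]
    exact ⟨Finset.mem_univ v, c, hc⟩
  have hcard : (n : ℝ) ≤ ∑ r ∈ Finset.range (k + 1), ((W r).card : ℝ) := by
    have := (Finset.card_le_card hcover).trans Finset.card_biUnion_le
    rw [Finset.card_univ, Fintype.card_fin] at this
    exact_mod_cast this
  have hterm : ∀ r ∈ Finset.range (k + 1), ((W r).card : ℝ) ≤
      if r * (k - r) = 0 then 11 / 10 * (((k : ℝ) + 1) * (k + 2))
        else 11 / 10 * ((k : ℝ) * (k + 1)) * β ^ (r * (k - r)) := by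
    intro r hr
    have hr : r ≤ k := Nat.lt_succ_iff.1 (Finset.mem_range.1 hr)
    have hnot : ¬ Coverable π r (k - r) := fun hcov => h.1 ⟨r, k - r, by omega, hcov⟩
    have hWr : ∀ v ∈ W r, ∃ c : Fin n → Fin r ⊕ Fin (k - r), IsCoverOff π v c :=
      fun v hv => (Finset.mem_filter.1 hv).2
    split_ifs with h0
    · have hlarge : (1 : ℝ) < (((k + 1 : ℕ) : ℝ) + 1) ^ ((k + 1 + 1) ^ 2) :=
        one_lt_pow₀ (by push_cast; linarith [(Nat.cast_nonneg k : (0 : ℝ) ≤ k)]) (by positivity)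
      have := card_le_of_isCoverOff hnot (t := k + 1) (by omega) (by omega) (by omega) hlarge
        (binEntropy_one_div_le (by omega) (by linarith)
          ((le_self_pow₀ hlarge.le (by omega)).trans
            (le_mul_of_one_le_right (by positivity) (one_le_pow₀ (by simp))))) (W r) hWr
      rw [h0, pow_zero, mul_one] at this
      push_cast at this
      linarith
    · have hr0 : r ≠ 0 := fun e => h0 (by simp [e])
      have hs0 : k - r ≠ 0 := fun e => h0 (by simp [e])
      exact card_le_of_isCoverOff hnot hk (by omega) (by omega) hβ
        (binEntropy_one_div_le (by omega) (by linarith) hpow) (W r) hWr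
  refine (hcard.trans (Finset.sum_le_sum hterm)).trans (hsum.trans ?_)
  have hk' : (3 : ℝ) ≤ k := by exact_mod_cast hk
  rw [← Real.rpow_natCast]
  refine Real.rpow_le_rpow_of_exponent_le (by linarith) ?_
  have := @Nat.cast_div_le ℝ _ _ _ (k ^ 2) 4
  push_cast at this ⊢
  linarith
end

section
/- If π is a separable permutation that is A-critical for some downset A, then the length of π equals |A|. In particular, every separable k-critical permutation has length (k+2)(k+1)/2, and every separable (r,s)-critical permutation has length (r+1)(s+1). -/
/-- Separable permutations: built from the length-1 permutation by direct and skew sums. -/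
inductive Separable : (n : ℕ) → Equiv.Perm (Fin n) → Prop
  | single : Separable 1 (Equiv.refl (Fin 1))
  | dsum {n m : ℕ} {π : Equiv.Perm (Fin n)} {σ : Equiv.Perm (Fin m)} :
      Separable n π → Separable m σ → Separable (n + m) (directSum π σ)
  | ssum {n m : ℕ} {π : Equiv.Perm (Fin n)} {σ : Equiv.Perm (Fin m)} :
      Separable n π → Separable m σ → Separable (n + m) (skewSum π σ)

/-- Exchanging increasing and decreasing: the complement of a permutation. -/
def complement {n : ℕ} (π : Equiv.Perm (Fin n)) : Equiv.Perm (Fin n) :=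
  π.trans Fin.revPerm

theorem complement_lt_complement {n : ℕ} (π : Equiv.Perm (Fin n)) (i j : Fin n) :
    complement π i < complement π j ↔ π j < π i := by
  simp [complement]

theorem complement_complement {n : ℕ} (π : Equiv.Perm (Fin n)) :
    complement (complement π) = π := by
  ext i
  simp [complement]

theorem complement_directSum {n m : ℕ} (π : Equiv.Perm (Fin n)) (σ : Equiv.Perm (Fin m)) :
    complement (directSum (complement π) (complement σ)) = skewSum π σ := by
  ext i
  refine Fin.addCases (fun i => ?_) (fun i => ?_) i
  · simp [complement, directSum, skewSum, Fin.val_rev]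
    omega
  · simp [complement, directSum, skewSum, Fin.val_rev]
    omega

theorem Coverable.complement {n : ℕ} {π : Equiv.Perm (Fin n)} {r s : ℕ}
    (h : Coverable π r s) : Coverable (complement π) s r := by
  obtain ⟨c, hi, hd⟩ := h
  have hswap : ∀ i x, (c i).swap = x → c i = x.swap := fun i x h => by rw [← h, Sum.swap_swap]
  refine ⟨fun i => (c i).swap, fun a i hx j hy hij => ?_, fun b i hx j hy hij => ?_⟩
  · rw [complement_lt_complement]
    exact hd a i (hswap i _ hx) j (hswap j _ hy) hij
  · rw [complement_lt_complement]
    exact hi b i (hswap i _ hx) j (hswap j _ hy) hij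

theorem coverable_complement_iff {n : ℕ} {π : Equiv.Perm (Fin n)} {r s : ℕ} :
    Coverable (complement π) r s ↔ Coverable π s r :=
  ⟨fun h => by simpa [complement_complement] using h.complement, fun h => h.complement⟩

theorem Pattern.complement {m n : ℕ} {τ : Equiv.Perm (Fin m)} {π : Equiv.Perm (Fin n)}
    (h : Pattern τ π) : Pattern (complement τ) (complement π) := by
  obtain ⟨f, hf, hτ⟩ := h
  exact ⟨f, hf, fun i j => by simp only [complement_lt_complement, hτ]⟩

theorem Coverable.mono {n : ℕ} {π : Equiv.Perm (Fin n)} {r s r' s' : ℕ}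
    (h : Coverable π r s) (hr : r ≤ r') (hs : s ≤ s') : Coverable π r' s' := by
  obtain ⟨c, hi, hd⟩ := h
  have hinj : Function.Injective (Sum.map (Fin.castLE hr) (Fin.castLE hs)) :=
    Sum.map_injective.2 ⟨Fin.castLE_injective hr, Fin.castLE_injective hs⟩
  refine ⟨fun i => Sum.map (Fin.castLE hr) (Fin.castLE hs) (c i),
    fun a i hx j hy hij => ?_, fun b i hx j hy hij => ?_⟩
  · have hc : c i = c j := hinj (hx.trans hy.symm)
    rcases h : c i with a' | b'
    · exact hi a' i h j (hc.symm.trans h) hij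
    · simp [h] at hx
  · have hc : c i = c j := hinj (hx.trans hy.symm)
    rcases h : c i with a' | b'
    · simp [h] at hx
    · exact hd b' i h j (hc.symm.trans h) hij

/-- A covering whose decreasing classes all lie in `S` needs only `S.card` of them. -/
theorem coverable_card {n r s : ℕ} {π : Equiv.Perm (Fin n)} (c : Fin n → Fin r ⊕ Fin s)
    (hi : ∀ a, IsIncOn π {i | c i = Sum.inl a}) (hd : ∀ b, IsDecOn π {i | c i = Sum.inr b})
    (S : Finset (Fin s)) (hS : ∀ i b, c i = Sum.inr b → b ∈ S) :
    Coverable π r S.card := by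
  classical
  have key : ∀ i, ∃ x : Fin r ⊕ Fin S.card,
      Sum.map id (fun k => ((S.equivFin.symm k : S) : Fin s)) x = c i := by
    intro i
    rcases h : c i with a | b
    · exact ⟨Sum.inl a, rfl⟩
    · exact ⟨Sum.inr (S.equivFin ⟨b, hS i b h⟩), by simp⟩
  choose d hdc using key
  refine ⟨d, fun a i hx j hy hij => hi a i ?_ j ?_ hij,
    fun b i hx j hy hij => hd (S.equivFin.symm b) i ?_ j ?_ hij⟩
  · simpa [show d i = _ from hx] using (hdc i).symm
  · simpa [show d j = _ from hy] using (hdc j).symm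
  · simpa [show d i = _ from hx] using (hdc i).symm
  · simpa [show d j = _ from hy] using (hdc j).symm

theorem directSum_castAdd {n m : ℕ} (π : Equiv.Perm (Fin n)) (σ : Equiv.Perm (Fin m))
    (i : Fin n) : directSum π σ (Fin.castAdd m i) = Fin.castAdd m (π i) := by
  simp [directSum]

theorem directSum_natAdd {n m : ℕ} (π : Equiv.Perm (Fin n)) (σ : Equiv.Perm (Fin m))
    (i : Fin m) : directSum π σ (Fin.natAdd n i) = Fin.natAdd n (σ i) := by
  simp [directSum]

theorem coverable_directSum_iff {n m r s : ℕ} {π : Equiv.Perm (Fin n)}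
    {σ : Equiv.Perm (Fin m)} :
    Coverable (directSum π σ) r s ↔
      ∃ s₁ s₂, s₁ + s₂ = s ∧ Coverable π r s₁ ∧ Coverable σ r s₂ := by
  classical
  constructor
  · rintro ⟨c, hi, hd⟩
    let S : Finset (Fin s) := {b | ∃ i, c (Fin.castAdd m i) = Sum.inr b}
    refine ⟨S.card, Sᶜ.card, by simp [Finset.card_add_card_compl],
      coverable_card (fun i => c (Fin.castAdd m i)) ?_ ?_ S ?_,
      coverable_card (fun i => c (Fin.natAdd n i)) ?_ ?_ Sᶜ ?_⟩
    · intro a i hx j hy hij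
      simpa only [directSum_castAdd, Fin.lt_def, Fin.val_castAdd] using
        hi a (Fin.castAdd m i) hx (Fin.castAdd m j) hy hij
    · intro a i hx j hy hij
      simpa only [directSum_castAdd, Fin.lt_def, Fin.val_castAdd] using
        hd a (Fin.castAdd m i) hx (Fin.castAdd m j) hy hij
    · intro i b h
      simpa [S] using ⟨i, h⟩
    · intro a i hx j hy hij
      simpa [directSum_natAdd] using
        hi a (Fin.natAdd n i) hx (Fin.natAdd n j) hy (by simpa using hij)
    · intro a i hx j hy hij
      simpa [directSum_natAdd] using
        hd a (Fin.natAdd n i) hx (Fin.natAdd n j) hy (by simpa using hij)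
    · intro i b h
      simp only [S, Finset.mem_compl, Finset.mem_filter, Finset.mem_univ, true_and]
      rintro ⟨j, hj⟩
      have := hd b (Fin.castAdd m j) hj (Fin.natAdd n i) h
        (by simp only [Fin.lt_def, Fin.val_castAdd, Fin.val_natAdd]; omega)
      rw [directSum_castAdd, directSum_natAdd] at this
      simp only [Fin.lt_def, Fin.val_castAdd, Fin.val_natAdd] at this
      omega
  · rintro ⟨s₁, s₂, rfl, ⟨c, hci, hcd⟩, ⟨d, hdi, hdd⟩⟩
    have hl : ∀ {β γ : Type} (f : β → γ) (x : Fin r ⊕ β) (a : Fin r),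
        Sum.map id f x = Sum.inl a → x = Sum.inl a := by
      rintro β γ f (x | x) a h <;> simp_all
    have hr : ∀ {β γ : Type} (f : β → γ) (x : Fin r ⊕ β) (b : γ),
        Sum.map id f x = Sum.inr b → ∃ b', x = Sum.inr b' ∧ f b' = b := by
      rintro β γ f (x | x) b h <;> simp_all
    refine ⟨Fin.addCases (fun i => Sum.map id (Fin.castAdd s₂) (c i))
      (fun i => Sum.map id (Fin.natAdd s₁) (d i)), fun a i hx j hy hij => ?_,
      fun b i hx j hy hij => ?_⟩
    · simp only [Set.mem_ofPred_eq] at hx hy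
      induction i using Fin.addCases <;> induction j using Fin.addCases <;>
        simp only [Fin.addCases_left, Fin.addCases_right, directSum_castAdd,
          directSum_natAdd] at hx hy ⊢ <;>
        simp only [Fin.lt_def, Fin.val_castAdd, Fin.val_natAdd] at hij ⊢
      · exact hci a _ (hl _ _ _ hx) _ (hl _ _ _ hy) hij
      · omega
      · omega
      · have := hdi a _ (hl _ _ _ hx) _ (hl _ _ _ hy) (by simpa using hij)
        simpa using this
    · simp only [Set.mem_ofPred_eq] at hx hy
      induction i using Fin.addCases <;> induction j using Fin.addCases <;>
        simp only [Fin.addCases_left, Fin.addCases_right, directSum_castAdd,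
          directSum_natAdd] at hx hy ⊢ <;>
        obtain ⟨x, hx, hxb⟩ := hr _ _ _ hx <;> obtain ⟨y, hy, hyb⟩ := hr _ _ _ hy <;>
        have hxy := congrArg Fin.val (hxb.trans hyb.symm) <;>
        simp only [Fin.lt_def, Fin.val_castAdd, Fin.val_natAdd] at hij hxy ⊢
      · obtain rfl := Fin.ext hxy
        exact hcd x _ hx _ hy hij
      · omega
      · omega
      · obtain rfl : x = y := Fin.ext (by omega)
        have := hdd x _ hx _ hy (by simpa using hij)
        simpa using this

theorem Pattern.refl {n : ℕ} (π : Equiv.Perm (Fin n)) : Pattern π π :=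
  ⟨id, strictMono_id, fun _ _ => Iff.rfl⟩

theorem Pattern.directSum {m n m' n' : ℕ} {τ : Equiv.Perm (Fin m)} {π : Equiv.Perm (Fin n)}
    {τ' : Equiv.Perm (Fin m')} {π' : Equiv.Perm (Fin n')} (h : Pattern τ π)
    (h' : Pattern τ' π') : Pattern (directSum τ τ') (directSum π π') := by
  obtain ⟨f, hf, hτ⟩ := h
  obtain ⟨g, hg, hτ'⟩ := h'
  refine ⟨Fin.addCases (fun i => Fin.castAdd n' (f i)) (fun i => Fin.natAdd n (g i)), ?_, ?_⟩
  · intro i j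
    induction i using Fin.addCases <;> induction j using Fin.addCases <;>
      intro hij <;>
      simp only [Fin.lt_def, Fin.addCases_left, Fin.addCases_right, Fin.val_castAdd,
        Fin.val_natAdd] at hij ⊢
    · exact hf hij
    · omega
    · omega
    · have := hg (show _ < _ from by simpa using hij)
      simpa using this
  · intro i j
    induction i using Fin.addCases <;> induction j using Fin.addCases <;>
      simp only [Fin.addCases_left, Fin.addCases_right, directSum_castAdd, directSum_natAdd] <;>
      simp only [Fin.lt_def, Fin.val_castAdd, Fin.val_natAdd]
    · exact hτ _ _
    · omega
    · omega
    · simpa using hτ' _ _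

/-- A downset is the region below a finitely supported function. -/
theorem IsDownset.exists_height {A : Set (ℕ × ℕ)} (hA : IsDownset A) :
    ∃ (h : ℕ → ℕ) (N : ℕ), (∀ r, N ≤ r → h r = 0) ∧ Antitone h ∧
      ∀ r s, (r, s) ∈ A ↔ s < h r := by
  classical
  obtain ⟨⟨N, M⟩, hb⟩ := hA.1.bddAbove
  have hex : ∀ r, ∃ s, (r, s) ∉ A := fun r => ⟨M + 1, fun h => by
    have := (hb h).2
    simp at this⟩
  have hmem : ∀ r s, (r, s) ∈ A ↔ s < Nat.find (hex r) := by
    intro r s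
    rw [Nat.lt_find_iff]
    exact ⟨fun h t ht hn => hn (hA.2 _ h _ le_rfl ht), fun h => not_not.1 (h s le_rfl)⟩
  refine ⟨fun r => Nat.find (hex r), N + 1, fun r hr => ?_, fun r r' hr => ?_, hmem⟩
  · rw [Nat.find_eq_zero]
    intro h
    have := (hb h).1
    simp at this
    omega
  · refine le_of_not_gt fun hlt => ?_
    have := (hmem r' _).2 hlt
    exact Nat.find_spec (hex r) (hA.2 _ this _ hr le_rfl)

theorem finite_ncard_of_height {A : Set (ℕ × ℕ)} {h : ℕ → ℕ} {N : ℕ}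
    (hN : ∀ r, N ≤ r → h r = 0) (hA : ∀ r s, (r, s) ∈ A ↔ s < h r) :
    A.Finite ∧ A.ncard = ∑ r ∈ Finset.range N, h r := by
  classical
  let F : Finset (ℕ × ℕ) := ((Finset.range N).sigma fun r => Finset.range (h r)).map
    (Equiv.sigmaEquivProd ℕ ℕ).toEmbedding
  have hF : A = F := by
    ext ⟨r, s⟩
    simp only [hA, F, Finset.coe_map, Set.mem_image, Finset.mem_coe, Finset.mem_sigma,
      Finset.mem_range]
    constructor
    · intro hs
      refine ⟨⟨r, s⟩, ⟨?_, hs⟩, rfl⟩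
      by_contra hr
      have := hN r (not_lt.1 hr)
      omega
    · rintro ⟨⟨r', s'⟩, ⟨-, hs⟩, heq⟩
      cases heq
      exact hs
  rw [hF, Set.ncard_coe_finset]
  refine ⟨F.finite_toSet, ?_⟩
  simp [F]

theorem mem_setOplus_iff {A B : Set (ℕ × ℕ)} {p q : ℕ → ℕ}
    (hA : ∀ r s, (r, s) ∈ A ↔ s < p r) (hB : ∀ r s, (r, s) ∈ B ↔ s < q r) (r s : ℕ) :
    (r, s) ∈ setOplus A B ↔ s < p r + q r := by
  simp only [setOplus, Set.mem_ofPred_eq, hA, hB]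
  constructor
  · intro h
    by_contra hs
    have := h (p r) (s - p r) (by omega)
    omega
  · intro h s₁ s₂ hs
    omega

theorem dSet_directSum {n m : ℕ} (π : Equiv.Perm (Fin n)) (σ : Equiv.Perm (Fin m)) :
    DSet (directSum π σ) = setOplus (DSet π) (DSet σ) := by
  ext ⟨r, s⟩
  simp only [DSet, setOplus, Set.mem_ofPred_eq, coverable_directSum_iff]
  push Not
  exact forall₂_congr fun s₁ s₂ => by tauto

theorem dSet_complement {n : ℕ} (π : Equiv.Perm (Fin n)) :
    DSet (complement π) = Prod.swap ⁻¹' DSet π := by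
  ext ⟨r, s⟩
  simp [DSet, coverable_complement_iff]

/-- `D(π)` has as many elements as `π`, and each maximal element of it can be removed by
passing to a proper pattern. -/
structure IsTight {n : ℕ} (π : Equiv.Perm (Fin n)) : Prop where
  finite : (DSet π).Finite
  ncard : (DSet π).ncard = n
  exists_pattern : ∀ c, Maximal (· ∈ DSet π) c →
    ∃ (m : ℕ) (τ : Equiv.Perm (Fin m)), ProperPattern τ π ∧ DSet π \ {c} ⊆ DSet τ

theorem IsTight.isDownset {n : ℕ} {π : Equiv.Perm (Fin n)} (h : IsTight π) :
    IsDownset (DSet π) :=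
  ⟨h.finite, fun _ hp _ h₁ h₂ hq => hp (hq.mono h₁ h₂)⟩

theorem IsTight.complement {n : ℕ} {π : Equiv.Perm (Fin n)} (h : IsTight π) :
    IsTight (complement π) where
  finite := by
    rw [dSet_complement]
    exact h.finite.preimage Prod.swap_injective.injOn
  ncard := by
    rw [dSet_complement, Set.ncard_preimage_of_injective_subset_range Prod.swap_injective
      (by simp [Prod.swap_surjective.range_eq]), h.ncard]
  exists_pattern := by
    intro c hc
    rw [dSet_complement] at hc ⊢
    obtain ⟨m, τ, ⟨hm, hτ⟩, hsub⟩ := h.exists_pattern c.swap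
      ⟨hc.1, fun d hd hle => Prod.swap_le_swap.1
        (by simpa using hc.2 (y := d.swap) (by simpa using hd)
              (by simpa using Prod.swap_le_swap.2 hle))⟩
    refine ⟨m, _, ⟨hm, hτ.complement⟩, ?_⟩
    rw [dSet_complement]
    rintro d ⟨hd, hne⟩
    exact hsub ⟨hd, fun heq => hne (Prod.swap_injective heq)⟩

/-- A strict descent of the height function gives a maximal element. -/
theorem maximal_of_height {A : Set (ℕ × ℕ)} {h : ℕ → ℕ} (hanti : Antitone h)
    (hA : ∀ r s, (r, s) ∈ A ↔ s < h r) {r : ℕ} (hr : h (r + 1) < h r) :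
    Maximal (· ∈ A) (r, h r - 1) := by
  refine ⟨(hA _ _).2 (by omega), ?_⟩
  rintro ⟨r', s'⟩ hmem ⟨h₁, h₂⟩
  simp only [hA] at hmem h₁ h₂
  rcases h₁.eq_or_lt with rfl | hlt
  · exact ⟨le_rfl, by simp only; omega⟩
  · have := hanti (Nat.succ_le_of_lt hlt)
    simp only [Nat.succ_eq_add_one] at this
    omega

theorem IsTight.directSum {n m : ℕ} {π : Equiv.Perm (Fin n)} {σ : Equiv.Perm (Fin m)}
    (hπ : IsTight π) (hσ : IsTight σ) : IsTight (directSum π σ) := by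
  obtain ⟨p, N, hpN, hp, hpmem⟩ := hπ.isDownset.exists_height
  obtain ⟨q, M, hqM, hq, hqmem⟩ := hσ.isDownset.exists_height
  have hmem := mem_setOplus_iff hpmem hqmem
  have hp0 : ∀ r, max N M ≤ r → p r = 0 := fun r hr => hpN r (by omega)
  have hq0 : ∀ r, max N M ≤ r → q r = 0 := fun r hr => hqM r (by omega)
  have hcard := finite_ncard_of_height (h := fun r => p r + q r) (N := max N M)
    (fun r hr => by simp [hp0 r hr, hq0 r hr]) hmem
  refine ⟨?_, ?_, ?_⟩
  · rw [dSet_directSum]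
    exact hcard.1
  · rw [dSet_directSum, hcard.2, Finset.sum_add_distrib,
      ← (finite_ncard_of_height hp0 hpmem).2, ← (finite_ncard_of_height hq0 hqmem).2,
      hπ.ncard, hσ.ncard]
  · rw [dSet_directSum]
    rintro ⟨r, s⟩ hc
    have hs : s < p r + q r := (hmem r s).1 hc.1
    have hup : p r + q r ≤ s + 1 := by
      by_contra hlt
      have := (hc.2 ((hmem r (s + 1)).2 (by omega)) ⟨le_rfl, by simp⟩).2
      simp at this
    have hright : p (r + 1) + q (r + 1) ≤ s := by
      by_contra hlt
      have := (hc.2 ((hmem (r + 1) s).2 (by omega)) ⟨by simp, le_rfl⟩).1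
      simp at this
    by_cases hpr : p (r + 1) < p r
    · obtain ⟨k, τ, ⟨hk, hτ⟩, hsub⟩ := hπ.exists_pattern _ (maximal_of_height hp hpmem hpr)
      refine ⟨_, _, ⟨by omega, hτ.directSum (Pattern.refl σ)⟩, ?_⟩
      rw [dSet_directSum]
      rintro ⟨r', s'⟩ ⟨hd, hne⟩ s₁ s₂ hsum
      have hd' := (hmem r' s').1 hd
      by_cases h₂ : s₂ < q r'
      · exact Or.inr ((hqmem _ _).2 h₂)
      · refine Or.inl (hsub ⟨(hpmem _ _).2 (by simp only at hsum ⊢; omega), fun heq => hne ?_⟩)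
        simp only [Set.mem_singleton_iff, Prod.mk.injEq] at heq hsum ⊢
        obtain ⟨rfl, heq⟩ := heq
        exact ⟨rfl, by omega⟩
    · have hqr : q (r + 1) < q r := by
        omega
      obtain ⟨k, τ, ⟨hk, hτ⟩, hsub⟩ := hσ.exists_pattern _ (maximal_of_height hq hqmem hqr)
      refine ⟨_, _, ⟨by omega, (Pattern.refl π).directSum hτ⟩, ?_⟩
      rw [dSet_directSum]
      rintro ⟨r', s'⟩ ⟨hd, hne⟩ s₁ s₂ hsum
      have hd' := (hmem r' s').1 hd
      by_cases h₁ : s₁ < p r'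
      · exact Or.inl ((hpmem _ _).2 h₁)
      · refine Or.inr (hsub ⟨(hqmem _ _).2 (by simp only at hsum ⊢; omega), fun heq => hne ?_⟩)
        simp only [Set.mem_singleton_iff, Prod.mk.injEq] at heq hsum ⊢
        obtain ⟨rfl, heq⟩ := heq
        exact ⟨rfl, by omega⟩

theorem isTight_single : IsTight (Equiv.refl (Fin 1)) := by
  have hD : DSet (Equiv.refl (Fin 1)) = {(0, 0)} := by
    ext ⟨r, s⟩
    simp only [DSet, Set.mem_ofPred_eq, Set.mem_singleton_iff, Prod.mk.injEq]
    constructor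
    · intro h
      by_contra hne
      refine h ?_
      have hlt : ∀ i j : Fin 1, ¬ i < j := fun i j => by simp [Subsingleton.elim i j]
      rcases Nat.eq_zero_or_pos r with hr | hr
      · exact ⟨fun _ => Sum.inr ⟨0, by omega⟩, fun _ i _ j _ hij => absurd hij (hlt i j),
          fun _ i _ j _ hij => absurd hij (hlt i j)⟩
      · exact ⟨fun _ => Sum.inl ⟨0, hr⟩, fun _ i _ j _ hij => absurd hij (hlt i j),
          fun _ i _ j _ hij => absurd hij (hlt i j)⟩
    · rintro ⟨rfl, rfl⟩ ⟨c, -⟩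
      exact (c 0).elim Fin.elim0 Fin.elim0
  refine ⟨by simp [hD], by simp [hD], fun c hc => ?_⟩
  have hc0 : c = (0, 0) := by simpa [hD] using hc.1
  exact ⟨0, Equiv.refl _, ⟨one_pos, Fin.elim0, fun i => i.elim0, fun i => i.elim0⟩,
    by simp [hD, hc0]⟩

theorem Separable.isTight {n : ℕ} {π : Equiv.Perm (Fin n)} (h : Separable n π) :
    IsTight π := by
  induction h with
  | single => exact isTight_single
  | dsum _ _ hπ hσ => exact hπ.directSum hσ
  | ssum _ _ hπ hσ =>
    rw [← complement_directSum]
    exact (hπ.complement.directSum hσ.complement).complement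

theorem not_aCoverable_iff {n : ℕ} {π : Equiv.Perm (Fin n)} {A : Set (ℕ × ℕ)} :
    ¬ ACoverable π A ↔ A ⊆ DSet π := by
  simp only [ACoverable, not_exists, not_and]
  rfl

theorem IsTight.eq_ncard {n : ℕ} {π : Equiv.Perm (Fin n)} (h : IsTight π) {A : Set (ℕ × ℕ)}
    (hA : IsDownset A) (hc : ACritical π A) : n = A.ncard := by
  have hsub := not_aCoverable_iff.1 hc.1
  suffices hD : DSet π ⊆ A by
    rw [hsub.antisymm hD, h.ncard]
  intro x hx
  by_contra hxA
  obtain ⟨c, hxc, hmax⟩ := h.finite.exists_le_maximal hx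
  obtain ⟨m, τ, hτ, hDτ⟩ := h.exists_pattern c hmax
  refine not_aCoverable_iff.2 (fun a ha => hDτ ⟨hsub ha, ?_⟩) (hc.2 m τ hτ)
  rintro rfl
  exact hxA (hA.2 _ ha _ hxc.1 hxc.2)

theorem kCoverable_iff {n : ℕ} {π : Equiv.Perm (Fin n)} {k : ℕ} :
    KCoverable π k ↔ ACoverable π (T k) := by
  constructor
  · rintro ⟨r, s, rfl, h⟩
    exact ⟨(r, s), le_refl (r + s), h⟩
  · rintro ⟨⟨r, s⟩, hp, h⟩
    have hp : r + s ≤ k := hp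
    exact ⟨r, k - r, by omega, h.mono le_rfl (by simp only; omega)⟩

theorem coverable_iff_aCoverable_Iic {n : ℕ} {π : Equiv.Perm (Fin n)} {r s : ℕ} :
    Coverable π r s ↔ ACoverable π (Set.Iic (r, s)) :=
  ⟨fun h => ⟨(r, s), Set.mem_Iic.2 le_rfl, h⟩, fun ⟨_, hp, h⟩ => h.mono hp.1 hp.2⟩

theorem isDownset_T (k : ℕ) : IsDownset (T k) := by
  refine ⟨(Set.finite_Iic (k, k)).subset fun p hp => ?_,
    fun p hp q h₁ h₂ => (add_le_add h₁ h₂).trans hp⟩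
  simp only [T, Set.mem_ofPred_eq] at hp
  exact ⟨by simp only; omega, by simp only; omega⟩

theorem ncard_T (k : ℕ) : (T k).ncard = (k + 2) * (k + 1) / 2 := by
  rw [(finite_ncard_of_height (h := fun r => k + 1 - r) (N := k + 2) (fun r hr => by omega)
    (fun r s => by simp only [T, Set.mem_ofPred_eq]; omega)).2]
  have h := Finset.sum_range_reflect (fun r => r) (k + 2)
  rw [Finset.sum_range_id] at h
  exact h

theorem isDownset_Iic (r s : ℕ) : IsDownset (Set.Iic (r, s)) :=
  ⟨Set.finite_Iic _, fun _ hp _ h₁ h₂ => le_trans (Prod.le_def.2 ⟨h₁, h₂⟩) hp⟩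

theorem ncard_Iic (r s : ℕ) : (Set.Iic (r, s)).ncard = (r + 1) * (s + 1) := by
  rw [← Set.Iic_prod_Iic, Set.ncard_prod]
  simp [← Finset.coe_Iic, Set.ncard_coe_finset]

/-- Corollary 17: a separable `A`-critical permutation has length `|A|`; in particular
separable `k`-critical permutations have length `(k+2)(k+1)/2` and separable
`(r,s)`-critical permutations have length `(r+1)(s+1)`. -/
theorem separable_critical_length :
    (∀ (n : ℕ) (π : Equiv.Perm (Fin n)) (A : Set (ℕ × ℕ)), IsDownset A →
      Separable n π → ACritical π A → n = A.ncard) ∧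
    (∀ (n k : ℕ) (π : Equiv.Perm (Fin n)), Separable n π → KCritical π k →
      n = (k + 2) * (k + 1) / 2) ∧
    (∀ (n r s : ℕ) (π : Equiv.Perm (Fin n)), Separable n π → RSCritical π r s →
      n = (r + 1) * (s + 1)) := by
  refine ⟨fun n π A hA hπ hc => hπ.isTight.eq_ncard hA hc, fun n k π hπ hc => ?_,
    fun n r s π hπ hc => ?_⟩
  · rw [← ncard_T]
    refine hπ.isTight.eq_ncard (isDownset_T k) ?_
    simpa only [ACritical, KCritical, kCoverable_iff] using hc
  · rw [← ncard_Iic]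
    refine hπ.isTight.eq_ncard (isDownset_Iic r s) ?_
    simpa only [ACritical, RSCritical, coverable_iff_aCoverable_Iic] using hc
end
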